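/- Let $p$ be prime, $l \geq 1$, and $P_1(t), \dots, P_l(t) \in \mathbb{Z}_p[t]$ monic polynomials of degree at most $2$ with distinct irreducible reductions mod $p$; set $q_j = p^{\deg P_j}$. For each $j$ let $G_j$ be a finite $\mathbb{Z}_p[t]/(P_j(t))$-module with $r_j := \dim_{\mathbb{F}_{q_j}}(G_j/pG_j)$. Then for every $n \geq 1$, the Haar probability that a random $X \in \mathrm{Mat}_n(\mathbb{Z}_p)$ satisfies $\mathrm{cok}(P_j(X)) \simeq G_j$ for all $j$ equals $\left(\prod_{j=1}^{l} \frac{q_j^{r_j^2}\prod_{i=1}^{r_j}(1 - q_j^{-i})^2}{|\mathrm{Aut}_{\mathbb{Z}_p[t]/(P_j(t))}(G_j)|}\right)$ times the probability that a uniformly random $\bar{X} \in \mathrm{Mat}_n(\mathbb{F}_p)$ satisfies $\mathrm{cok}(P_j(\bar{X})) \simeq G_j/pG_j$ for all $j$. -/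

import Mathlib

open MeasureTheory Pointwise

noncomputable instance (p : ℕ) [Fact p.Prime] : MeasurableSpace ℤ_[p] := borel _


/-! ### Elementary counting -/

lemma ck_sum_card_comm {A B : Type*} [Fintype A] [Fintype B] (r : A → B → Prop) :
    ∑ a, Nat.card {b // r a b} = ∑ b, Nat.card {a // r a b} := by
  classical
  simp_rw [Nat.card_eq_fintype_card, Fintype.card_subtype, Finset.card_filter]
  exact Finset.sum_comm

/-- number of solutions of `φ a = b` for a surjective hom -/
lemma ck_card_fiber {A B : Type*} [AddCommGroup A] [AddCommGroup B] [Finite A] [Finite B]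
    (φ : A →+ B) (hφ : Function.Surjective φ) (b : B) :
    Nat.card {a // φ a = b} * Nat.card B = Nat.card A := by
  classical
  have := Fintype.ofFinite A
  have := Fintype.ofFinite B
  have key : ∀ b : B, Nat.card {a // φ a = b} = Nat.card {a // φ a = 0} := by
    intro b
    obtain ⟨a0, ha0⟩ := hφ b
    refine Nat.card_congr ⟨fun a => ⟨a.1 - a0, by simp [a.2, ha0]⟩,
      fun a => ⟨a.1 + a0, by simp [a.2, ha0]⟩, fun a => by simp, fun a => by simp⟩
  have h1 : Nat.card A = ∑ b : B, Nat.card {a // φ a = b} := by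
    rw [← Nat.card_sigma]
    exact Nat.card_congr (Equiv.sigmaFiberEquiv φ).symm
  rw [h1, Finset.sum_congr rfl (fun b' _ => (key b').trans (key b).symm)]
  simp [mul_comm]

/-- the additive subgroup of multiples of `p` -/
def ckP (p : ℕ) (G : Type*) [AddCommGroup G] : AddSubgroup G := (nsmulAddMonoidHom p : G →+ G).range

lemma ck_mem_ckP {p : ℕ} {G : Type*} [AddCommGroup G] {x : G} :
    x ∈ ckP p G ↔ ∃ y, p • y = x := Iff.rfl

lemma ck_card_fiber_p {A G : Type*} [AddCommGroup A] [AddCommGroup G] [Finite A] [Finite G]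
    (p : ℕ) (φ : A →+ G) (hφ : Function.Surjective φ) (b : G) (hb : b ∈ ckP p G) :
    Nat.card {a // p • φ a = b} * Nat.card (ckP p G) = Nat.card A := by
  have h := ck_card_fiber (((nsmulAddMonoidHom p : G →+ G).rangeRestrict).comp φ)
    ((AddMonoidHom.rangeRestrict_surjective _).comp hφ) ⟨b, hb⟩
  rw [← h]
  congr 1
  exact Nat.card_congr (Equiv.subtypeEquivRight fun a => by
    rw [Subtype.ext_iff]; rfl)

lemma ck_nakayama {G : Type*} [AddCommGroup G] (p N : ℕ) (hN : ∀ x : G, p ^ N • x = 0)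
    (I : AddSubgroup G) (hI : ∀ x : G, ∃ y ∈ I, ∃ z : G, x = y + p • z) : I = ⊤ := by
  have key : ∀ k : ℕ, ∀ x : G, ∃ y ∈ I, ∃ z : G, x = y + p ^ k • z := by
    intro k
    induction k with
    | zero => intro x; exact ⟨0, I.zero_mem, x, by simp⟩
    | succ k ih =>
      intro x
      obtain ⟨y, hy, z, hz⟩ := ih x
      obtain ⟨y', hy', z', hz'⟩ := hI z
      refine ⟨y + p ^ k • y', I.add_mem hy (I.nsmul_mem hy' _), z', ?_⟩
      rw [hz, hz', smul_add, ← add_assoc, pow_succ, mul_smul]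
  rw [eq_top_iff]
  rintro x -
  obtain ⟨y, hy, z, hz⟩ := key N x
  rw [hz, hN, add_zero]; exact hy

section mod
variable {R : Type} [CommRing R]

lemma ck_mem_smul_top {p : ℕ} {G : Type*} [AddCommGroup G] [Module R G] {x : G} :
    x ∈ ((p : R) • (⊤ : Submodule R G)) ↔ ∃ y, p • y = x := by
  rw [Submodule.mem_smul_pointwise_iff_exists]
  simp [Nat.cast_smul_eq_nsmul]

/-- The number of surjective linear maps. -/
noncomputable def ckSur (R : Type) [CommRing R] (C G : Type*) [AddCommGroup C] [Module R C]
    [AddCommGroup G] [Module R G] : ℕ := Nat.card {φ : C →ₗ[R] G // Function.Surjective φ}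

lemma ckSur_congr {C C' G : Type*} [AddCommGroup C] [Module R C] [AddCommGroup C'] [Module R C']
    [AddCommGroup G] [Module R G] (e : C ≃ₗ[R] C') : ckSur R C G = ckSur R C' G := by
  refine Nat.card_congr ⟨fun φ => ⟨φ.1 ∘ₗ e.symm.toLinearMap, φ.2.comp e.symm.surjective⟩,
    fun φ => ⟨φ.1 ∘ₗ e.toLinearMap, φ.2.comp e.surjective⟩, fun φ => ?_, fun φ => ?_⟩
  · ext; simp
  · ext; simp

/-- number of generating tuples -/
noncomputable def ckGen (R : Type) [CommRing R] (G : Type*) [AddCommGroup G] [Module R G]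
    (m : ℕ) : ℕ := Nat.card {f : Fin m → G // Submodule.span R (Set.range f) = ⊤}

lemma ckSur_quot {m : ℕ} (K : Submodule R (Fin m → R)) (G : Type*) [AddCommGroup G] [Module R G] :
    ckSur R ((Fin m → R) ⧸ K) G =
      Nat.card {f : Fin m → G // Submodule.span R (Set.range f) = ⊤ ∧
        ∀ v ∈ K, Fintype.linearCombination R f v = 0} := by
  symm
  refine Nat.card_congr (Equiv.ofBijective
    (fun f => ⟨K.liftQ (Fintype.linearCombination R f.1) (fun v hv => LinearMap.mem_ker.2 (f.2.2 v hv)), ?_⟩) ⟨?_, ?_⟩)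
  · rw [← LinearMap.range_eq_top, Submodule.range_liftQ, Fintype.range_linearCombination]
    exact f.2.1
  · intro f g h
    ext i
    have := congrArg (fun φ => φ.1 (K.mkQ (Pi.single i 1))) h
    simpa [Fintype.linearCombination_apply_single] using this
  · rintro ⟨φ, hφ⟩
    have h0 : Fintype.linearCombination R (fun i => φ (K.mkQ (Pi.single i 1))) = φ ∘ₗ K.mkQ := by
      ext i; simp
    refine ⟨⟨fun i => φ (K.mkQ (Pi.single i 1)), ?_, ?_⟩, ?_⟩
    · rw [← Fintype.range_linearCombination, h0, LinearMap.range_eq_top]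
      exact hφ.comp K.mkQ_surjective
    · intro v hv
      rw [h0]; simp [(Submodule.Quotient.mk_eq_zero K).2 hv]
    · ext i
      simp

end mod


section mod2
variable {R : Type} [CommRing R]

lemma ck_card_fun_quot {G : Type*} [AddCommGroup G] [Module R G] [Finite G] (S : Submodule R G)
    (m : ℕ) (Q : (Fin m → G ⧸ S) → Prop) :
    Nat.card {f : Fin m → G // Q (fun i => S.mkQ (f i))} =
      Nat.card S ^ m * Nat.card {f : Fin m → G ⧸ S // Q f} := by
  classical
  have : Finite (G ⧸ S) := Finite.of_surjective _ S.mkQ_surjective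
  have := Fintype.ofFinite (G ⧸ S)
  let φ : (Fin m → G) →+ (Fin m → G ⧸ S) :=
    { toFun := fun f i => S.mkQ (f i), map_zero' := by ext; simp, map_add' := by intros; ext; simp }
  have hφ : Function.Surjective φ := fun g =>
    ⟨fun i => (S.mkQ_surjective (g i)).choose, funext fun i => (S.mkQ_surjective (g i)).choose_spec⟩
  have hpos : 0 < Nat.card (Fin m → G ⧸ S) := Nat.card_pos
  have hfib : ∀ g, Nat.card {f // φ f = g} = Nat.card S ^ m := by
    intro g
    have h := ck_card_fiber φ hφ g
    have h2 : Nat.card (Fin m → G) = Nat.card S ^ m * Nat.card (Fin m → G ⧸ S) := by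
      simp only [Nat.card_fun, Nat.card_eq_fintype_card (α := Fin m), Fintype.card_fin]
      rw [← mul_pow, ← Submodule.card_eq_card_quotient_mul_card]
    rw [h2] at h
    exact Nat.eq_of_mul_eq_mul_right hpos h
  have e : {f : Fin m → G // Q (φ f)} ≃ Σ g : {g : Fin m → G ⧸ S // Q g}, {f // φ f = g.1} :=
    ⟨fun f => ⟨⟨φ f.1, f.2⟩, ⟨f.1, rfl⟩⟩, fun x => ⟨x.2.1, by rw [x.2.2]; exact x.1.2⟩,
      fun f => rfl, by
        rintro ⟨⟨g, hg⟩, ⟨f, hf⟩⟩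
        have hf' : φ f = g := hf
        subst hf'; rfl⟩
  have : Nat.card {f : Fin m → G // Q (φ f)} = _ := Nat.card_congr e
  rw [Nat.card_sigma] at this
  simp only [hfib] at this
  simp only [Finset.sum_const, Finset.card_univ, smul_eq_mul] at this
  rw [Nat.card_eq_fintype_card (α := {f : Fin m → G ⧸ S // Q f}), mul_comm]
  exact this

lemma ck_card_smul_top (p : ℕ) (G : Type*) [AddCommGroup G] [Module R G] :
    Nat.card ((p : R) • (⊤ : Submodule R G) : Submodule R G) = Nat.card (ckP p G) :=
  Nat.card_congr (Equiv.subtypeEquivRight fun x => by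
    rw [ck_mem_smul_top, ck_mem_ckP])

lemma ck_gen_iff {G : Type*} [AddCommGroup G] [Module R G] (p N : ℕ) (hN : ∀ x : G, p ^ N • x = 0)
    {m : ℕ} (f : Fin m → G) :
    Submodule.span R (Set.range fun i => ((p : R) • (⊤ : Submodule R G)).mkQ (f i)) = ⊤ ↔
      Submodule.span R (Set.range f) = ⊤ := by
  set S := ((p : R) • (⊤ : Submodule R G))
  have h1 : Submodule.span R (Set.range fun i => S.mkQ (f i)) =
      (Submodule.span R (Set.range f)).map S.mkQ := by
    rw [Submodule.map_span, ← Set.range_comp]; rfl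
  rw [h1]
  constructor
  · intro h
    rw [← Submodule.toAddSubgroup_inj]
    apply ck_nakayama p N hN
    intro x
    have hx : S.mkQ x ∈ (Submodule.span R (Set.range f)).map S.mkQ := by rw [h]; trivial
    obtain ⟨y, hy, hyx⟩ := hx
    have : x - y ∈ S := by
      rw [← Submodule.Quotient.mk_eq_zero, Submodule.Quotient.mk_sub, sub_eq_zero]
      exact hyx.symm
    obtain ⟨z, hz⟩ := ck_mem_smul_top.1 this
    exact ⟨y, hy, z, by rw [hz]; abel⟩
  · intro h
    rw [h, Submodule.map_top, Submodule.range_mkQ]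

lemma ckGen_quot {G : Type*} [AddCommGroup G] [Module R G] [Finite G] (p N : ℕ)
    (hN : ∀ x : G, p ^ N • x = 0) (m : ℕ) :
    ckGen R G m = Nat.card (ckP p G) ^ m * ckGen R (G ⧸ ((p : R) • (⊤ : Submodule R G))) m := by
  rw [ckGen, ckGen, ← ck_card_smul_top (R := R), ← ck_card_fun_quot]
  exact Nat.card_congr (Equiv.subtypeEquivRight fun f => (ck_gen_iff p N hN f).symm)

lemma ckGen_rel_quot {G : Type*} [AddCommGroup G] [Module R G] [Finite G] (p N : ℕ)
    (hN : ∀ x : G, p ^ N • x = 0) (m : ℕ) (A : Fin m → Fin m → R) :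
    Nat.card {f : Fin m → G // Submodule.span R (Set.range f) = ⊤ ∧
        ∀ i, Fintype.linearCombination R f (fun k => A k i) ∈ ckP p G} =
      Nat.card (ckP p G) ^ m *
      Nat.card {f : Fin m → G ⧸ ((p : R) • (⊤ : Submodule R G)) //
        Submodule.span R (Set.range f) = ⊤ ∧
        ∀ i, Fintype.linearCombination R f (fun k => A k i) = 0} := by
  rw [← ck_card_smul_top (R := R), ← ck_card_fun_quot]
  refine Nat.card_congr (Equiv.subtypeEquivRight fun f => and_congr (ck_gen_iff p N hN f).symm
    (forall_congr' fun i => ?_))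
  rw [ck_mem_ckP, ← ck_mem_smul_top (R := R), ← Submodule.Quotient.mk_eq_zero,
    ← Submodule.mkQ_apply]
  simp [Fintype.linearCombination_apply]

/-- presented module `R^n / (columns of A, c)` -/
abbrev ckK {n : ℕ} (A : Fin n → Fin n → R) (c : R) : Submodule R (Fin n → R) :=
  Submodule.span R (Set.range (fun i k => A k i) ∪ Set.range (fun i => Pi.single i c))

lemma ckK_rel {n : ℕ} (A : Fin n → Fin n → R) (c : R) {G : Type*} [AddCommGroup G] [Module R G]
    (hc : ∀ x : G, c • x = 0) (f : Fin n → G) :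
    (∀ v ∈ ckK A c, Fintype.linearCombination R f v = 0) ↔
      ∀ i, Fintype.linearCombination R f (fun k => A k i) = 0 := by
  constructor
  · intro h i
    exact h _ (Submodule.subset_span (Or.inl ⟨i, rfl⟩))
  · intro h
    have : ckK A c ≤ LinearMap.ker (Fintype.linearCombination R f) := by
      rw [Submodule.span_le]
      rintro _ (⟨i, rfl⟩ | ⟨i, rfl⟩)
      · exact h i
      · simp [Fintype.linearCombination_apply_single, hc]
    exact fun v hv => this hv

lemma ckSur_K {n : ℕ} (A : Fin n → Fin n → R) (c : R) {G : Type*} [AddCommGroup G] [Module R G]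
    (hc : ∀ x : G, c • x = 0) :
    ckSur R ((Fin n → R) ⧸ ckK A c) G =
      Nat.card {f : Fin n → G // Submodule.span R (Set.range f) = ⊤ ∧
        ∀ i, Fintype.linearCombination R f (fun k => A k i) = 0} := by
  rw [ckSur_quot]
  exact Nat.card_congr (Equiv.subtypeEquivRight fun f => and_congr_right fun _ =>
    ckK_rel A c hc f)

lemma ckK_smul {n : ℕ} (A : Fin n → Fin n → R) (c : R) (x : (Fin n → R) ⧸ ckK A c) :
    c • x = 0 := by
  obtain ⟨v, rfl⟩ := Submodule.Quotient.mk_surjective _ x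
  rw [← Submodule.Quotient.mk_smul, Submodule.Quotient.mk_eq_zero]
  have : c • v = ∑ i, v i • (Pi.single i c : Fin n → R) := by
    ext k
    simp [Finset.sum_apply, Pi.single_apply, mul_comm]
  rw [this]
  exact Submodule.sum_mem _ fun i _ => Submodule.smul_mem _ _
    (Submodule.subset_span (Or.inr ⟨i, rfl⟩))

end mod2

/-! ### Uniqueness -/

theorem ck_unique {J : Type} [Fintype J] (R : J → Type) [∀ j, CommRing (R j)] (p N : ℕ)
    {Ω : Type} [Fintype Ω] (w : Ω → ℝ) (C : Ω → J → Type) [∀ ω j, AddCommGroup (C ω j)]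
    [∀ ω j, Module (R j) (C ω j)] [∀ ω j, Finite (C ω j)]
    (hC : ∀ ω j (x : C ω j), p ^ N • x = 0)
    (hmom : ∀ (G : J → Type) [∀ j, AddCommGroup (G j)] [∀ j, Module (R j) (G j)]
      [∀ j, Finite (G j)], (∀ j (x : G j), p ^ N • x = 0) →
      ∑ ω, w ω * ((∏ j, ckSur (R j) (C ω j) (G j) : ℕ) : ℝ) = 0)
    (G : J → Type) [∀ j, AddCommGroup (G j)] [∀ j, Module (R j) (G j)] [∀ j, Finite (G j)]
    (hG : ∀ j (x : G j), p ^ N • x = 0) [DecidablePred fun ω => ∀ j, Nonempty (C ω j ≃ₗ[R j] G j)] :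
    ∑ ω with (∀ j, Nonempty (C ω j ≃ₗ[R j] G j)), w ω = 0 := by
  classical
  obtain ⟨M, hM⟩ : ∃ M, M = (Finset.univ.filter fun ω =>
    (∏ j, Nat.card (G j)) < ∏ j, Nat.card (C ω j)).card := ⟨_, rfl⟩
  induction M using Nat.strong_induction_on generalizing G with
  | _ M ih =>
  have h := hmom G hG
  -- zero outside
  have hsplit : ∀ ω, w ω * ((∏ j, ckSur (R j) (C ω j) (G j) : ℕ) : ℝ) =
      (if (∏ j, Nat.card (G j)) < ∏ j, Nat.card (C ω j) then
        w ω * ((∏ j, ckSur (R j) (C ω j) (G j) : ℕ) : ℝ) else 0) +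
      (if (∀ j, Nonempty (C ω j ≃ₗ[R j] G j)) then
        w ω * ((∏ j, ckSur (R j) (G j) (G j) : ℕ) : ℝ) else 0) := by
    intro ω
    by_cases h1 : (∀ j, Nonempty (C ω j ≃ₗ[R j] G j))
    · have h2 : ¬ (∏ j, Nat.card (G j)) < ∏ j, Nat.card (C ω j) := by
        rw [not_lt]
        exact (Finset.prod_congr rfl fun j _ => Nat.card_congr (h1 j).some.toEquiv).le
      rw [if_neg h2, if_pos h1, zero_add]
      congr 2
      exact Finset.prod_congr rfl fun j _ => ckSur_congr (h1 j).some
    · rw [if_neg h1, add_zero]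
      split_ifs with h2
      · rfl
      · -- some surj count is zero
        rw [not_lt] at h2
        have : ∏ j, ckSur (R j) (C ω j) (G j) = 0 := by
          by_contra hne
          rw [Finset.prod_eq_zero_iff] at hne
          push Not at hne
          apply h1
          have hs : ∀ j, ∃ φ : C ω j →ₗ[R j] G j, Function.Surjective φ := by
            intro j
            have := hne j (Finset.mem_univ j)
            have hn := (Nat.card_ne_zero.1 this).1
            exact ⟨hn.some.1, hn.some.2⟩
          have hle : ∀ j ∈ Finset.univ, Nat.card (G j) ≤ Nat.card (C ω j) := fun j _ =>
            Nat.card_le_card_of_surjective _ (hs j).choose_spec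
          have heq : ∀ j, Nat.card (G j) = Nat.card (C ω j) := by
            by_contra hcon
            push Not at hcon
            obtain ⟨j, hj⟩ := hcon
            have : ∏ j, Nat.card (G j) < ∏ j, Nat.card (C ω j) :=
              Finset.prod_lt_prod (fun j _ => Nat.card_pos) hle
                ⟨j, Finset.mem_univ j, lt_of_le_of_ne (hle j (Finset.mem_univ j)) hj⟩
            omega
          intro j
          obtain ⟨φ, hφ⟩ := hs j
          refine ⟨LinearEquiv.ofBijective φ ?_⟩
          exact (Nat.bijective_iff_surjective_and_card φ).2 ⟨hφ, (heq j).symm⟩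
        rw [this]; simp
  rw [Finset.sum_congr rfl (fun ω _ => hsplit ω), Finset.sum_add_distrib] at h
  -- first sum vanishes
  have hfirst : ∑ ω, (if (∏ j, Nat.card (G j)) < ∏ j, Nat.card (C ω j) then
        w ω * ((∏ j, ckSur (R j) (C ω j) (G j) : ℕ) : ℝ) else 0) = 0 := by
    rw [← Finset.sum_filter]
    let s : Setoid Ω := ⟨fun a b => ∀ j, Nonempty (C a j ≃ₗ[R j] C b j),
      fun a j => ⟨LinearEquiv.refl _ _⟩, fun h j => ⟨(h j).some.symm⟩,
      fun h h' j => ⟨(h j).some.trans (h' j).some⟩⟩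
    rw [← Finset.sum_fiberwise _ (fun ω => (Quotient.mk s ω))]
    refine Finset.sum_eq_zero fun c _ => ?_
    induction c using Quotient.inductionOn with
    | _ ω0 =>
    have hrel : ∀ ω, Quotient.mk s ω = Quotient.mk s ω0 ↔
        ∀ j, Nonempty (C ω j ≃ₗ[R j] C ω0 j) := fun ω => Quotient.eq (r := s)
    have hcard : ∀ ω, (∀ j, Nonempty (C ω j ≃ₗ[R j] C ω0 j)) →
        ∏ j, Nat.card (C ω j) = ∏ j, Nat.card (C ω0 j) := fun ω hω =>
      Finset.prod_congr rfl fun j _ => Nat.card_congr (hω j).some.toEquiv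
    by_cases hbig : (∏ j, Nat.card (G j)) < ∏ j, Nat.card (C ω0 j)
    · have := ih (Finset.univ.filter fun ω =>
          (∏ j, Nat.card (C ω0 j)) < ∏ j, Nat.card (C ω j)).card ?_ (C ω0) (hC ω0) rfl
      · have h2 : ∑ ω with (∀ j, Nonempty (C ω j ≃ₗ[R j] C ω0 j)),
            w ω * ((∏ j, ckSur (R j) (C ω0 j) (G j) : ℕ) : ℝ) = 0 := by
          rw [← Finset.sum_mul, this, zero_mul]
        rw [← h2, Finset.filter_filter]
        refine Finset.sum_congr ?_ ?_
        · ext ω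
          simp only [Finset.mem_filter, Finset.mem_univ, true_and, hrel]
          exact ⟨fun h => h.2, fun h => ⟨by rw [hcard ω h]; exact hbig, h⟩⟩
        · intro ω hω
          have hω' := (Finset.mem_filter.1 hω).2
          congr 2
          exact Finset.prod_congr rfl fun j _ => ckSur_congr (hω' j).some
      · rw [hM]
        apply Finset.card_lt_card
        rw [Finset.ssubset_iff_of_subset]
        · exact ⟨ω0, by simpa using hbig, by simp⟩
        · intro ω hω
          simp only [Finset.mem_filter, Finset.mem_univ, true_and] at hω ⊢
          exact hbig.trans hω
    · rw [Finset.filter_filter]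
      refine Finset.sum_eq_zero fun ω hω => ?_
      simp only [Finset.mem_filter, Finset.mem_univ, true_and, hrel] at hω
      rw [hcard ω hω.2] at hω
      exact absurd hω.1 hbig
  rw [hfirst, zero_add, ← Finset.sum_filter, ← Finset.sum_mul] at h
  have hpos : ((∏ j, ckSur (R j) (G j) (G j) : ℕ) : ℝ) ≠ 0 := by
    rw [Nat.cast_ne_zero, Finset.prod_ne_zero_iff]
    intro j _
    have : Finite {φ : G j →ₗ[R j] G j // Function.Surjective φ} :=
      Finite.of_injective (fun φ => (φ.1 : G j → G j)) (fun a b h => Subtype.ext (DFunLike.coe_injective h))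
    have : Nonempty {φ : G j →ₗ[R j] G j // Function.Surjective φ} :=
      ⟨LinearMap.id, Function.surjective_id⟩
    exact Nat.card_pos.ne'
  have := (mul_eq_zero.1 h).resolve_right hpos
  convert this


section mod3
variable {R : Type} [CommRing R]

lemma ckSur_free (I : Ideal R) (r : ℕ) {G : Type*} [AddCommGroup G] [Module R G]
    (hI : ∀ a ∈ I, ∀ x : G, a • x = 0) : ckSur R (Fin r → R ⧸ I) G = ckGen R G r := by
  let φ : (Fin r → R) →ₗ[R] (Fin r → R ⧸ I) := LinearMap.pi fun i => I.mkQ ∘ₗ LinearMap.proj i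
  have hφ : Function.Surjective φ := fun g =>
    ⟨fun i => (I.mkQ_surjective (g i)).choose, funext fun i => (I.mkQ_surjective (g i)).choose_spec⟩
  rw [← ckSur_congr (LinearMap.quotKerEquivOfSurjective φ hφ), ckSur_quot, ckGen]
  refine Nat.card_congr (Equiv.subtypeEquivRight fun f => ⟨fun h => h.1, fun h => ⟨h, ?_⟩⟩)
  intro v hv
  have hv' : ∀ i, v i ∈ I := by
    intro i
    have := congrFun (LinearMap.mem_ker.1 hv) i
    exact (Submodule.Quotient.mk_eq_zero I).1 this
  rw [Fintype.linearCombination_apply]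
  exact Finset.sum_eq_zero fun i _ => hI _ (hv' i) _

variable (p q : ℕ)

lemma ck_field_stuff (hmax : (Ideal.span {(p : R)}).IsMaximal)
    (hcard : Nat.card (R ⧸ Ideal.span {(p : R)}) = q) (hq : 1 < q)
    {H : Type*} [AddCommGroup H] [Module R H] [Finite H] (hH : ∀ x : H, p • x = 0) {r : ℕ}
    (hr : Nat.card H = q ^ r) :
    Nonempty (H ≃ₗ[R] (Fin r → R ⧸ Ideal.span {(p : R)})) ∧
      ckGen R H r = ∏ i : Fin r, (q ^ r - q ^ (i : ℕ)) := by
  set I := Ideal.span {(p : R)} with hI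
  let : Field (R ⧸ I) := Ideal.Quotient.field I
  have htor : Module.IsTorsionBySet R H I := by
    rw [hI, Module.isTorsionBySet_span_singleton_iff]
    intro x
    rw [Nat.cast_smul_eq_nsmul, hH]
  let : Module (R ⧸ I) H := htor.module
  have : IsScalarTower R (R ⧸ I) H := htor.isScalarTower
  have : Finite (R ⧸ I) := by
    apply Nat.finite_of_card_ne_zero; omega
  let := Fintype.ofFinite (R ⧸ I)
  have hfr : Module.finrank (R ⧸ I) H = r := by
    have h1 := Module.natCard_eq_pow_finrank (K := R ⧸ I) (V := H)
    rw [hr, hcard] at h1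
    exact (Nat.pow_right_injective hq h1).symm
  refine ⟨⟨?_⟩, ?_⟩
  · have e : H ≃ₗ[R ⧸ I] (Fin r → R ⧸ I) := LinearEquiv.ofFinrankEq _ _ (by simp [hfr])
    exact e.restrictScalars R
  · have h2 := card_linearIndependent (K := R ⧸ I) (V := H) (k := r) hfr.ge
    rw [← Nat.card_eq_fintype_card, hcard, hfr] at h2
    rw [← h2, ckGen]
    refine Nat.card_congr (Equiv.subtypeEquivRight fun f => ?_)
    have h3 : Submodule.span R (Set.range f) = ⊤ ↔ Submodule.span (R ⧸ I) (Set.range f) = ⊤ := by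
      rw [← Submodule.restrictScalars_span R (R ⧸ I) Ideal.Quotient.mk_surjective,
        Submodule.restrictScalars_eq_top_iff]
    rw [h3]
    constructor
    · intro h
      exact linearIndependent_of_top_le_span_of_card_eq_finrank h.ge (by simp [hfr])
    · intro h
      exact h.span_eq_top_of_card_eq_finrank' (by simp [hfr])

variable [IsDomain R] [IsPrincipalIdealRing R]

lemma ck_card_pow (hp0 : (p : R) ≠ 0) (hmax : (Ideal.span {(p : R)}).IsMaximal)
    (hcard : Nat.card (R ⧸ Ideal.span {(p : R)}) = q) (N : ℕ) :
    Nat.card (R ⧸ Ideal.span {(p : R) ^ N}) = q ^ N := by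
  have := hmax.isPrime
  have h := cardQuot_pow_of_prime (P := Ideal.span {(p : R)}) (by simpa using hp0) (i := N)
  rw [Submodule.cardQuot_apply, Submodule.cardQuot_apply, hcard] at h
  rw [← h, Ideal.span_singleton_pow]

/-- torsion counts in cyclic modules -/
lemma ck_card_tor (hp0 : (p : R) ≠ 0) (hmax : (Ideal.span {(p : R)}).IsMaximal)
    (hcard : Nat.card (R ⧸ Ideal.span {(p : R)}) = q) (k m : ℕ) :
    Nat.card {x : R ⧸ Ideal.span {(p : R) ^ k} // p ^ m • x = 0} = q ^ (min m k) := by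
  have hc := ck_card_pow p q hp0 hmax hcard
  rcases le_total k m with h | h
  · rw [min_eq_right h, ← hc k]
    apply Nat.card_congr
    refine (Equiv.subtypeUnivEquiv fun x => ?_)
    obtain ⟨x, rfl⟩ := Ideal.Quotient.mk_surjective x
    rw [← map_nsmul, Ideal.Quotient.eq_zero_iff_mem, Ideal.mem_span_singleton, nsmul_eq_mul]
    push_cast
    exact Dvd.dvd.mul_right (pow_dvd_pow _ h) _
  · rw [min_eq_left h, ← hc m]
    symm
    have hkm : (p : R) ^ k = p ^ (k - m) * p ^ m := by rw [← pow_add]; congr 1; omega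
    let φ : R →ₗ[R] R ⧸ Ideal.span {(p : R) ^ k} :=
      (Ideal.span {(p : R) ^ k}).mkQ ∘ₗ LinearMap.mulLeft R ((p : R) ^ (k - m))
    have hφ : ∀ x, φ x = Ideal.Quotient.mk _ ((p : R) ^ (k - m) * x) := fun x => rfl
    have hker : Ideal.span {(p : R) ^ m} = LinearMap.ker φ := by
      ext x
      rw [LinearMap.mem_ker, hφ, Ideal.Quotient.eq_zero_iff_mem, Ideal.mem_span_singleton,
        Ideal.mem_span_singleton, hkm]
      exact (mul_dvd_mul_iff_left (pow_ne_zero _ hp0)).symm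
    rw [hker]
    refine Nat.card_congr (φ.quotKerEquivRange.toEquiv.trans (Equiv.subtypeEquivRight fun x => ?_))
    obtain ⟨x, rfl⟩ := Ideal.Quotient.mk_surjective x
    rw [← map_nsmul, Ideal.Quotient.eq_zero_iff_mem, Ideal.mem_span_singleton, nsmul_eq_mul,
      LinearMap.mem_range]
    push_cast
    constructor
    · rintro ⟨y, hy⟩
      rw [hφ, Ideal.Quotient.eq, Ideal.mem_span_singleton] at hy
      have h1 : (p : R) ^ k ∣ p ^ m * (p ^ (k - m) * y) := by
        rw [← mul_assoc, mul_comm ((p : R) ^ m), ← hkm]; exact dvd_mul_right _ _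
      have h2 := Dvd.dvd.mul_left hy ((p : R) ^ m)
      rw [mul_sub] at h2
      exact (dvd_sub_right h1).1 h2
    · intro hx
      rw [hkm, mul_comm] at hx
      obtain ⟨y, rfl⟩ := (mul_dvd_mul_iff_left (pow_ne_zero m hp0)).1 hx
      exact ⟨y, rfl⟩

lemma ck_decomp (hp0 : (p : R) ≠ 0) (hmax : (Ideal.span {(p : R)}).IsMaximal)
    {G : Type*} [AddCommGroup G] [Module R G] [Finite G] (N : ℕ) (hN : ∀ x : G, p ^ N • x = 0) :
    ∃ (d : ℕ) (k : Fin d → ℕ),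
      Nonempty (G ≃ₗ[R] ((i : Fin d) → R ⧸ Ideal.span {(p : R) ^ k i})) := by
  have hirr : Irreducible (p : R) := ((Ideal.span_singleton_prime hp0).1 hmax.isPrime).irreducible
  obtain ⟨d, k, ⟨e⟩⟩ := Module.torsion_by_prime_power_decomposition (M := G) hirr (by
    intro x
    refine ⟨⟨(p : R) ^ N, N, rfl⟩, ?_⟩
    change ((p : R) ^ N) • x = 0
    rw [← Nat.cast_pow, Nat.cast_smul_eq_nsmul, hN])
  exact ⟨d, k, ⟨e.trans (DirectSum.linearEquivFunOnFintype R (Fin d) _)⟩⟩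

lemma ck_pi_drop {d : ℕ} (k : Fin d → ℕ) :
    Nonempty (((i : Fin d) → R ⧸ Ideal.span {(p : R) ^ k i}) ≃ₗ[R]
      ((i : {i : Fin d // k i ≠ 0}) → R ⧸ Ideal.span {(p : R) ^ k i})) := by
  let φ : ((i : Fin d) → R ⧸ Ideal.span {(p : R) ^ k i}) →ₗ[R]
      ((i : {i : Fin d // k i ≠ 0}) → R ⧸ Ideal.span {(p : R) ^ k i}) :=
    LinearMap.pi fun i => LinearMap.proj i.1
  refine ⟨LinearEquiv.ofBijective φ ⟨?_, ?_⟩⟩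
  · intro x y h
    ext i
    by_cases hi : k i = 0
    · have : Subsingleton (R ⧸ Ideal.span {(p : R) ^ k i}) := by
        rw [Submodule.Quotient.subsingleton_iff, hi]; simp
      exact Subsingleton.elim _ _
    · exact congrFun h ⟨i, hi⟩
  · classical
    intro y
    refine ⟨fun i => if h : k i ≠ 0 then y ⟨i, h⟩ else 0, ?_⟩
    ext ⟨i, hi⟩
    exact dif_pos hi

theorem ck_classify (hp0 : (p : R) ≠ 0) (hmax : (Ideal.span {(p : R)}).IsMaximal)
    (hcard : Nat.card (R ⧸ Ideal.span {(p : R)}) = q) (hq : 1 < q)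
    {G H : Type} [AddCommGroup G] [Module R G] [Finite G] [AddCommGroup H] [Module R H]
    (N : ℕ) (hN : ∀ x : G, p ^ N • x = 0) (e : G ≃+ H) : Nonempty (G ≃ₗ[R] H) := by
  classical
  have : Finite H := Finite.of_equiv _ e.toEquiv
  have hNH : ∀ x : H, p ^ N • x = 0 := fun x => by
    rw [← e.apply_symm_apply x, ← map_nsmul, hN, map_zero]
  have count : ∀ (G : Type) [AddCommGroup G] [Module R G] (d : ℕ) (k : Fin d → ℕ)
      (e : G ≃ₗ[R] ((i : Fin d) → R ⧸ Ideal.span {(p : R) ^ k i})) (m : ℕ),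
      Nat.card {x : G // p ^ m • x = 0} = q ^ (∑ i, min m (k i)) := by
    intro G _ _ d k e m
    rw [← Finset.prod_pow_eq_pow_sum]
    simp_rw [← ck_card_tor p q hp0 hmax hcard]
    rw [← Nat.card_pi]
    refine Nat.card_congr ⟨fun x i => ⟨e x.1 i, ?_⟩, fun y => ⟨e.symm fun i => (y i).1, ?_⟩, ?_, ?_⟩
    · rw [← Pi.smul_apply, ← map_nsmul, x.2]; simp
    · rw [← map_nsmul]
      convert map_zero e.symm
      ext i
      exact (y i).2
    · intro x; simp
    · intro y; simp
  obtain ⟨d, k, ⟨eG⟩⟩ := ck_decomp p hp0 hmax N hN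
  obtain ⟨d', k', ⟨eH⟩⟩ := ck_decomp p hp0 hmax N hNH
  have hsum : ∀ m, ∑ i, min m (k i) = ∑ i, min m (k' i) := by
    intro m
    apply Nat.pow_right_injective hq
    change q ^ _ = q ^ _
    rw [← count G d k eG m, ← count H d' k' eH m]
    exact Nat.card_congr (Equiv.subtypeEquiv e.toEquiv fun x => by
      change _ ↔ p ^ m • e x = 0
      rw [← map_nsmul, EmbeddingLike.map_eq_zero_iff])
  have hstep : ∀ {d : ℕ} (k : Fin d → ℕ) (m : ℕ), ∑ i, min (m + 1) (k i) =
      ∑ i, min m (k i) + (Finset.univ.filter fun i => m < k i).card := by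
    intro d k m
    rw [Finset.card_filter, ← Finset.sum_add_distrib]
    refine Finset.sum_congr rfl fun i _ => ?_
    split_ifs <;> omega
  have hgt : ∀ m, (Finset.univ.filter fun i => m < k i).card =
      (Finset.univ.filter fun i => m < k' i).card := by
    intro m
    have h1 := hstep k m
    have h2 := hstep k' m
    rw [hsum, hsum] at h1
    omega
  have hstep2 : ∀ {d : ℕ} (k : Fin d → ℕ) (m : ℕ), (Finset.univ.filter fun i => m < k i).card =
      (Finset.univ.filter fun i => m + 1 < k i).card +
      (Finset.univ.filter fun i => k i = m + 1).card := by
    intro d k m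
    simp_rw [Finset.card_filter]
    rw [← Finset.sum_add_distrib]
    refine Finset.sum_congr rfl fun i _ => ?_
    split_ifs <;> omega
  have heq : ∀ m, (Finset.univ.filter fun i => k i = m + 1).card =
      (Finset.univ.filter fun i => k' i = m + 1).card := by
    intro m
    have h1 := hstep2 k m
    have h2 := hstep2 k' m
    rw [hgt, hgt] at h1
    omega
  have hfib : ∀ c : ℕ, Nonempty ({a : {i : Fin d // k i ≠ 0} // k a = c} ≃
      {a : {i : Fin d' // k' i ≠ 0} // k' a = c}) := by
    intro c
    rcases c with _ | m
    · have : IsEmpty {a : {i : Fin d // k i ≠ 0} // k a = 0} := ⟨fun a => a.1.2 a.2⟩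
      have : IsEmpty {a : {i : Fin d' // k' i ≠ 0} // k' a = 0} := ⟨fun a => a.1.2 a.2⟩
      exact ⟨Equiv.equivOfIsEmpty _ _⟩
    · have e1 : ∀ {d : ℕ} (k : Fin d → ℕ), Nonempty
          ({a : {i : Fin d // k i ≠ 0} // k a = m + 1} ≃ {i : Fin d // k i = m + 1}) := fun k =>
        ⟨⟨fun a => ⟨a.1.1, a.2⟩, fun i => ⟨⟨i.1, by rw [i.2]; omega⟩, i.2⟩, fun a => rfl,
          fun a => rfl⟩⟩
      have e2 : Nonempty ({i : Fin d // k i = m + 1} ≃ {i : Fin d' // k' i = m + 1}) := by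
        rw [← Fintype.card_eq, Fintype.card_subtype, Fintype.card_subtype]
        exact heq m
      exact ⟨(e1 k).some.trans (e2.some.trans (e1 k').some.symm)⟩
  let σ : {i : Fin d // k i ≠ 0} ≃ {i : Fin d' // k' i ≠ 0} :=
    Equiv.ofFiberEquiv (f := fun a => k a.1) (g := fun a => k' a.1) (fun c => (hfib c).some)
  have hσ : ∀ a, k' (σ a).1 = k a.1 := fun a =>
    Equiv.ofFiberEquiv_map (f := fun a : {i : Fin d // k i ≠ 0} => k a.1)
      (g := fun a : {i : Fin d' // k' i ≠ 0} => k' a.1) (fun c => (hfib c).some) a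
  have e3 : ((i : {i : Fin d // k i ≠ 0}) → R ⧸ Ideal.span {(p : R) ^ k i}) ≃ₗ[R]
      ((i : {i : Fin d // k i ≠ 0}) → R ⧸ Ideal.span {(p : R) ^ k' (σ i).1}) :=
    LinearEquiv.piCongrRight fun i => Submodule.quotEquivOfEq _ _ (by rw [hσ])
  have e4 : ((i : {i : Fin d // k i ≠ 0}) → R ⧸ Ideal.span {(p : R) ^ k' (σ i).1}) ≃ₗ[R]
      ((i : {i : Fin d' // k' i ≠ 0}) → R ⧸ Ideal.span {(p : R) ^ k' i.1}) :=
    LinearEquiv.piCongrLeft R (fun i : {i : Fin d' // k' i ≠ 0} =>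
      R ⧸ Ideal.span {(p : R) ^ k' i.1}) σ
  exact ⟨eG.trans <| (ck_pi_drop p k).some.trans <| e3.trans <| e4.trans <|
    (ck_pi_drop p k').some.symm.trans eH.symm⟩

end mod3


section mod4
variable {R : Type} [CommRing R]

lemma ckSur_quot' {U G : Type*} [AddCommGroup U] [Module R U] [AddCommGroup G] [Module R G]
    (K : Submodule R U) :
    ckSur R (U ⧸ K) G =
      Nat.card {F : {F : U →ₗ[R] G // Function.Surjective F} // K ≤ LinearMap.ker F.1} := by
  symm
  refine Nat.card_congr (Equiv.ofBijective
    (fun f => ⟨K.liftQ f.1.1 f.2, ?_⟩) ⟨?_, ?_⟩)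
  · rw [← LinearMap.range_eq_top, Submodule.range_liftQ]
    exact LinearMap.range_eq_top.2 f.1.2
  · intro f g h
    ext x
    exact congrArg (fun φ => φ.1 (K.mkQ x)) h
  · rintro ⟨φ, hφ⟩
    refine ⟨⟨⟨φ ∘ₗ K.mkQ, hφ.comp K.mkQ_surjective⟩, ?_⟩, ?_⟩
    · intro v hv
      simp [(Submodule.Quotient.mk_eq_zero K).2 hv]
    · ext i
      simp

lemma ckIso_quot {U G : Type*} [AddCommGroup U] [Module R U] [AddCommGroup G] [Module R G]
    (K : Submodule R U) :
    Nat.card ((U ⧸ K) ≃ₗ[R] G) =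
      Nat.card {F : {F : U →ₗ[R] G // Function.Surjective F} // K = LinearMap.ker F.1} := by
  symm
  refine Nat.card_congr (Equiv.ofBijective
    (fun f => LinearEquiv.ofBijective (K.liftQ f.1.1 f.2.le) ⟨?_, ?_⟩) ⟨?_, ?_⟩)
  · rw [← LinearMap.ker_eq_bot, Submodule.ker_liftQ_eq_bot]
    exact f.2.ge
  · rw [← LinearMap.range_eq_top, Submodule.range_liftQ]
    exact LinearMap.range_eq_top.2 f.1.2
  · intro f g h
    ext x
    exact congrArg (fun φ : (U ⧸ K) ≃ₗ[R] G => φ (K.mkQ x)) h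
  · intro φ
    refine ⟨⟨⟨φ.toLinearMap ∘ₗ K.mkQ, φ.surjective.comp K.mkQ_surjective⟩, ?_⟩, ?_⟩
    · rw [LinearMap.ker_comp, LinearEquiv.ker, Submodule.comap_bot, Submodule.ker_mkQ]
    · ext x
      obtain ⟨x, rfl⟩ := K.mkQ_surjective x
      rfl

variable (p : ℕ)

/-- the second model -/
abbrev ckC2 {U : Type*} [AddCommGroup U] [Module R U] {r : ℕ} (z : Fin r → U) : Type _ :=
  U ⧸ Submodule.span R (Set.range fun i => p • z i)

lemma ck_finite_hom (U G : Type*) [AddCommGroup U] [Module R U] [AddCommGroup G] [Module R G]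
    [Finite U] [Finite G] : Finite (U →ₗ[R] G) :=
  Finite.of_injective (fun φ => (φ : U → G)) DFunLike.coe_injective

lemma ck_card_tuple {U G : Type*} [AddCommGroup U] [AddCommGroup G] [Finite U] [Finite G]
    {r : ℕ} (φ : U →+ G) (hφ : Function.Surjective φ) (b : Fin r → G) (hb : ∀ i, b i ∈ ckP p G) :
    Nat.card {z : Fin r → U // ∀ i, p • φ (z i) = b i} * Nat.card (ckP p G) ^ r
      = Nat.card U ^ r := by
  have e : Nat.card {z : Fin r → U // ∀ i, p • φ (z i) = b i} =
      ∏ i : Fin r, Nat.card {u : U // p • φ u = b i} := by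
    rw [← Nat.card_pi]
    exact Nat.card_congr (Equiv.subtypePiEquivPi (p := fun i u => p • φ u = b i))
  have h2 : Nat.card (ckP p G) ^ r = ∏ i : Fin r, Nat.card (ckP p G) := by simp
  rw [e, h2, ← Finset.prod_mul_distrib, Finset.prod_congr rfl
    (fun i _ => ck_card_fiber_p p φ hφ (b i) (hb i))]
  simp

lemma ck_m2_moment (N r : ℕ) [Finite (R ⧸ Ideal.span {(p : R) ^ N})]
    [Fintype (Fin r → Fin r → R ⧸ Ideal.span {(p : R) ^ N})]
    {G : Type} [AddCommGroup G] [Module R G] [Finite G] (hN : ∀ x : G, p ^ N • x = 0) :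
    ∑ z : Fin r → Fin r → R ⧸ Ideal.span {(p : R) ^ N}, ckSur R (ckC2 (R := R) p z) G =
      Nat.card (Fin r → Fin r → R ⧸ Ideal.span {(p : R) ^ N}) *
        ckGen R (G ⧸ ((p : R) • (⊤ : Submodule R G))) r := by
  classical
  let U := Fin r → R ⧸ Ideal.span {(p : R) ^ N}
  have := ck_finite_hom (R := R) U G
  let := Fintype.ofFinite {F : U →ₗ[R] G // Function.Surjective F}
  have h0 : ∀ z : Fin r → Fin r → R ⧸ Ideal.span {(p : R) ^ N}, ckSur R (ckC2 (R := R) p z) G =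
      Nat.card {F : {F : U →ₗ[R] G // Function.Surjective F} //
        Submodule.span R (Set.range fun i => p • z i) ≤ LinearMap.ker F.1} :=
    fun z => ckSur_quot' _
  rw [Finset.sum_congr rfl (fun z _ => h0 z)]
  rw [ck_sum_card_comm (fun (z : Fin r → Fin r → R ⧸ Ideal.span {(p : R) ^ N})
    (F : {F : U →ₗ[R] G // Function.Surjective F}) =>
      Submodule.span R (Set.range fun i => p • z i) ≤ LinearMap.ker F.1)]
  have hpos : 0 < Nat.card (ckP p G) ^ r := pow_pos Nat.card_pos _
  apply Nat.eq_of_mul_eq_mul_right hpos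
  rw [Finset.sum_mul]
  have key : ∀ F : {F : U →ₗ[R] G // Function.Surjective F},
      Nat.card {z : Fin r → U // Submodule.span R (Set.range fun i => p • z i) ≤ LinearMap.ker F.1} *
        Nat.card (ckP p G) ^ r = Nat.card U ^ r := by
    intro F
    rw [← ck_card_tuple p F.1.toAddMonoidHom F.2 (fun _ : Fin r => 0) (fun _ => zero_mem _)]
    congr 1
    refine Nat.card_congr (Equiv.subtypeEquivRight fun z => ?_)
    rw [Submodule.span_le]
    constructor
    · intro h i
      have : p • z i ∈ LinearMap.ker F.1 := h ⟨i, rfl⟩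
      rw [LinearMap.mem_ker, map_nsmul] at this
      exact this
    · rintro h _ ⟨i, rfl⟩
      change p • z i ∈ LinearMap.ker F.1
      rw [LinearMap.mem_ker, map_nsmul]
      exact h i
  rw [Finset.sum_congr rfl (fun F _ => key F), Finset.sum_const, Finset.card_univ, smul_eq_mul,
    ← Nat.card_eq_fintype_card]
  have h1 : Nat.card {F : U →ₗ[R] G // Function.Surjective F} = ckGen R G r := by
    apply ckSur_free
    intro a ha x
    obtain ⟨b, rfl⟩ := Ideal.mem_span_singleton.1 ha
    rw [mul_comm, mul_smul, ← Nat.cast_pow, Nat.cast_smul_eq_nsmul, hN, smul_zero]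
  rw [h1, ckGen_quot p N hN r, Nat.card_fun (α := Fin r) (β := U)]
  simp only [Nat.card_eq_fintype_card (α := Fin r), Fintype.card_fin]
  ring

lemma ck_tor_mul (G : Type*) [AddCommGroup G] [Finite G] :
    Nat.card {x : G // p • x = 0} * Nat.card (ckP p G) = Nat.card G :=
  ck_card_fiber_p p (AddMonoidHom.id G) Function.surjective_id 0 (zero_mem _)

lemma ck_quot_mul (G : Type*) [AddCommGroup G] [Module R G] :
    Nat.card G = Nat.card (ckP p G) * Nat.card (G ⧸ ((p : R) • (⊤ : Submodule R G))) := by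
  rw [← ck_card_smul_top (R := R)]
  exact Submodule.card_eq_card_quotient_mul_card _

lemma ck_quot_killed (G : Type*) [AddCommGroup G] [Module R G]
    (x : G ⧸ ((p : R) • (⊤ : Submodule R G))) : p • x = 0 := by
  obtain ⟨x, rfl⟩ := Submodule.Quotient.mk_surjective _ x
  rw [← Submodule.Quotient.mk_smul, Submodule.Quotient.mk_eq_zero, ck_mem_smul_top]
  exact ⟨x, rfl⟩

variable (q : ℕ) [IsDomain R] [IsPrincipalIdealRing R]

lemma ck_m2_iso (hp0 : (p : R) ≠ 0) (hmax : (Ideal.span {(p : R)}).IsMaximal)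
    (hcard : Nat.card (R ⧸ Ideal.span {(p : R)}) = q) (hq : 1 < q) (N r : ℕ)
    [Finite (R ⧸ Ideal.span {(p : R) ^ (N + 1)})]
    {G : Type} [AddCommGroup G] [Module R G] [Finite G] (hN : ∀ x : G, p ^ N • x = 0)
    (hr : Nat.card (G ⧸ ((p : R) • (⊤ : Submodule R G))) = q ^ r) :
    Nat.card {z : Fin r → Fin r → R ⧸ Ideal.span {(p : R) ^ (N + 1)} //
        Nonempty (ckC2 (R := R) p z ≃ₗ[R] G)} * Nat.card (G ≃ₗ[R] G) * q ^ (r ^ 2) =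
      Nat.card (Fin r → Fin r → R ⧸ Ideal.span {(p : R) ^ (N + 1)}) *
        (∏ i : Fin r, (q ^ r - q ^ (i : ℕ))) ^ 2 := by
  classical
  set U := Fin r → R ⧸ Ideal.span {(p : R) ^ (N + 1)} with hU
  have hUN : ∀ x : U, p ^ (N + 1) • x = 0 := by
    intro x
    ext i
    obtain ⟨a, ha⟩ := Ideal.Quotient.mk_surjective (x i)
    rw [Pi.smul_apply, ← ha, ← map_nsmul, Pi.zero_apply, Ideal.Quotient.eq_zero_iff_mem,
      Ideal.mem_span_singleton, nsmul_eq_mul]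
    push_cast
    exact dvd_mul_right _ _
  have := ck_finite_hom (R := R) U G
  let := Fintype.ofFinite {F : U →ₗ[R] G // Function.Surjective F}
  let := Fintype.ofFinite (Fin r → U)
  set B := ∏ i : Fin r, (q ^ r - q ^ (i : ℕ)) with hB
  -- torsion of U
  have hUtor : Nat.card {x : U // p • x = 0} = q ^ r := by
    have h1 := ck_card_tor p q hp0 hmax hcard (N + 1) 1
    rw [pow_one, min_eq_left (by omega), pow_one] at h1
    have : Nat.card {x : U // p • x = 0} =
        ∏ i : Fin r, Nat.card {x : R ⧸ Ideal.span {(p : R) ^ (N + 1)} // p • x = 0} := by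
      rw [← Nat.card_pi]
      refine Nat.card_congr ((Equiv.subtypeEquivRight fun x => ?_).trans
        (Equiv.subtypePiEquivPi (p := fun i x => p • x = 0)))
      exact funext_iff
    rw [this, h1]; simp
  have hUcard := ck_tor_mul p U
  rw [hUtor] at hUcard
  have hUquot : Nat.card (U ⧸ ((p : R) • (⊤ : Submodule R U))) = q ^ r := by
    have h := ck_quot_mul (R := R) p U
    rw [← hUcard, mul_comm] at h
    exact (Nat.eq_of_mul_eq_mul_left Nat.card_pos h).symm
  have hUdiv : ∀ x : U, p • x = 0 → ∃ y, p ^ N • y = x := by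
    intro x hx
    have : ∀ i, ∃ y, p ^ N • y = x i := by
      intro i
      obtain ⟨a, ha⟩ := Ideal.Quotient.mk_surjective (x i)
      have h := congrFun hx i
      rw [Pi.smul_apply, ← ha, ← map_nsmul, Pi.zero_apply, Ideal.Quotient.eq_zero_iff_mem,
        Ideal.mem_span_singleton, nsmul_eq_mul, pow_succ, mul_comm] at h
      obtain ⟨b, hb⟩ := (mul_dvd_mul_iff_left hp0).1 h
      refine ⟨Ideal.Quotient.mk _ b, ?_⟩
      rw [← map_nsmul, ← ha, hb, nsmul_eq_mul]
      push_cast; rfl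
    choose y hy using this
    exact ⟨y, funext hy⟩
  have hN' : ∀ x : G, p ^ (N + 1) • x = 0 := fun x => by
    rw [pow_succ, mul_comm, mul_smul, hN, smul_zero]
  have hGgen : ckGen R G r = Nat.card (ckP p G) ^ r * B := by
    have : Finite (G ⧸ ((p : R) • (⊤ : Submodule R G))) :=
      Finite.of_surjective _ (Submodule.mkQ_surjective _)
    rw [ckGen_quot p _ hN', (ck_field_stuff p q hmax hcard hq (ck_quot_killed p G) hr).2]
  have hSur : Nat.card {F : U →ₗ[R] G // Function.Surjective F} = ckGen R G r := by
    apply ckSur_free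
    intro a ha x
    obtain ⟨b, rfl⟩ := Ideal.mem_span_singleton.1 ha
    rw [mul_comm, mul_smul, ← Nat.cast_pow, Nat.cast_smul_eq_nsmul, hN', smul_zero]
  -- left side as sum
  have hleft : Nat.card {z : Fin r → U // Nonempty (ckC2 (R := R) p z ≃ₗ[R] G)} *
      Nat.card (G ≃ₗ[R] G) = ∑ z : Fin r → U, Nat.card (ckC2 (R := R) p z ≃ₗ[R] G) := by
    rw [Nat.card_eq_fintype_card, Fintype.card_subtype, Finset.card_filter, Finset.sum_mul]
    refine Finset.sum_congr rfl fun z _ => ?_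
    split_ifs with h
    · rw [one_mul]
      obtain ⟨e⟩ := h
      exact Nat.card_congr ⟨fun f => e.trans f, fun f => e.symm.trans f,
        fun f => by ext; simp, fun f => by ext; simp⟩
    · rw [zero_mul]
      have := not_nonempty_iff.1 h
      simp
  rw [hleft]
  simp_rw [ckIso_quot]
  rw [ck_sum_card_comm]
  have hposU : 0 < Nat.card (ckP p U) := Nat.card_pos
  have key : ∀ F : {F : U →ₗ[R] G // Function.Surjective F},
      Nat.card {z : Fin r → U // Submodule.span R (Set.range fun i => p • z i) = LinearMap.ker F.1} *
        Nat.card (ckP p U) ^ r =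
        Nat.card (ckP p (LinearMap.ker F.1)) ^ r * B * Nat.card U ^ r ∧
      Nat.card (LinearMap.ker F.1) = q ^ r * Nat.card (ckP p (LinearMap.ker F.1)) := by
    rintro ⟨F, hF⟩
    set K := LinearMap.ker F with hK
    have hKU : ∀ x ∈ K, x ∈ ckP p U := by
      intro x hx
      let Fb : (U ⧸ ((p : R) • (⊤ : Submodule R U))) →ₗ[R] (G ⧸ ((p : R) • (⊤ : Submodule R G))) :=
        Submodule.mapQ _ _ F (by
          intro x hx
          obtain ⟨y, rfl⟩ := ck_mem_smul_top.1 hx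
          rw [Submodule.mem_comap, map_nsmul, ck_mem_smul_top]
          exact ⟨_, rfl⟩)
      have hsurj : Function.Surjective Fb := by
        intro g
        obtain ⟨g, rfl⟩ := Submodule.Quotient.mk_surjective _ g
        obtain ⟨u, rfl⟩ := hF g
        exact ⟨Submodule.Quotient.mk u, rfl⟩
      have : Finite (U ⧸ ((p : R) • (⊤ : Submodule R U))) :=
        Finite.of_surjective _ (Submodule.mkQ_surjective _)
      have hbij := (Nat.bijective_iff_surjective_and_card Fb).2 ⟨hsurj, by rw [hr, hUquot]⟩
      have h0 : Fb (Submodule.Quotient.mk x) = 0 := by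
        have : F x = 0 := hx
        simp [Fb, Submodule.mapQ_apply, this]
      have h1 := hbij.1 (h0.trans (map_zero Fb).symm)
      rw [Submodule.Quotient.mk_eq_zero, ck_mem_smul_top] at h1
      exact h1
    have hKN : ∀ x : K, p ^ (N + 1) • x = 0 := fun x => Subtype.ext (hUN x)
    have hKtor : Nat.card {x : K // p • x = 0} = q ^ r := by
      rw [← hUtor]
      refine Nat.card_congr ⟨fun x => ⟨x.1.1, congrArg Subtype.val x.2⟩,
        fun x => ⟨⟨x.1, ?_⟩, Subtype.ext x.2⟩, fun x => rfl, fun x => rfl⟩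
      obtain ⟨y, hy⟩ := hUdiv x.1 x.2
      rw [hK, LinearMap.mem_ker, ← hy, map_nsmul, hN]
    have hKquot : Nat.card (K ⧸ ((p : R) • (⊤ : Submodule R K))) = q ^ r := by
      have h := ck_quot_mul (R := R) p K
      rw [← ck_tor_mul p K, hKtor, mul_comm] at h
      exact (Nat.eq_of_mul_eq_mul_left Nat.card_pos h).symm
    have hKgen : ckGen R K r = Nat.card (ckP p K) ^ r * B := by
      have : Finite (K ⧸ ((p : R) • (⊤ : Submodule R K))) :=
        Finite.of_surjective _ (Submodule.mkQ_surjective _)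
      rw [ckGen_quot p _ hKN, (ck_field_stuff p q hmax hcard hq (ck_quot_killed p K) hKquot).2]
    refine ⟨?_, by rw [← hKtor, ck_tor_mul]⟩
    rw [← hKgen]
    have hspan : ∀ w : Fin r → K, Submodule.span R (Set.range w) = ⊤ ↔
        Submodule.span R (Set.range fun i => (w i : U)) = K := by
      intro w
      have : Submodule.span R (Set.range fun i => (w i : U)) =
          (Submodule.span R (Set.range w)).map K.subtype := by
        rw [Submodule.map_span, ← Set.range_comp]; rfl
      rw [this]
      constructor
      · intro h; rw [h]; simp
      · intro h
        apply Submodule.map_injective_of_injective K.injective_subtype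
        rw [h]; simp
    let e : {z : Fin r → U // Submodule.span R (Set.range fun i => p • z i) = K} ≃
        Σ w : {w : Fin r → K // Submodule.span R (Set.range w) = ⊤},
          {z : Fin r → U // ∀ i, p • (AddMonoidHom.id U) (z i) = (w.1 i : U)} :=
      { toFun := fun z => ⟨⟨fun i => ⟨p • z.1 i, by
            exact z.2.le (Submodule.subset_span ⟨i, rfl⟩)⟩, (hspan _).2 z.2⟩,
            ⟨z.1, fun i => rfl⟩⟩
        invFun := fun x => ⟨x.2.1, by
            have h1 := (hspan _).1 x.1.2
            refine Eq.trans ?_ h1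
            congr 2
            ext1 i
            exact x.2.2 i⟩
        left_inv := fun z => rfl
        right_inv := by
          rintro ⟨⟨w, hw⟩, ⟨z, hz⟩⟩
          have hw' : (fun i => (⟨p • z i, (hz i).symm ▸ (w i).2⟩ : K)) = w :=
            funext fun i => Subtype.ext (hz i)
          exact Sigma.subtype_ext (Subtype.ext hw') rfl }
    rw [Nat.card_congr e]
    let := Fintype.ofFinite {w : Fin r → K // Submodule.span R (Set.range w) = ⊤}
    rw [Nat.card_sigma, Finset.sum_mul]
    rw [Finset.sum_congr rfl (fun w _ => ck_card_tuple p (AddMonoidHom.id U)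
      Function.surjective_id _ (fun i => hKU _ (w.1 i).2))]
    rw [Finset.sum_const, Finset.card_univ, smul_eq_mul, ckGen,
      Nat.card_eq_fintype_card (α := {w : Fin r → K // Submodule.span R (Set.range w) = ⊤})]
  have hGcard := ck_quot_mul (R := R) p G
  rw [hr] at hGcard
  have hposG : 0 < Nat.card (ckP p G) := Nat.card_pos
  have key' : ∀ F : {F : U →ₗ[R] G // Function.Surjective F},
      Nat.card {z : Fin r → U // Submodule.span R (Set.range fun i => p • z i) = LinearMap.ker F.1} *
        (Nat.card (ckP p G) ^ r * q ^ (r ^ 2)) = B * Nat.card U ^ r := by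
    intro F
    obtain ⟨h1, h2⟩ := key F
    have h3 : Nat.card U = Nat.card (LinearMap.ker F.1) * Nat.card G := by
      rw [Submodule.card_eq_card_quotient_mul_card (LinearMap.ker F.1),
        Nat.card_congr (LinearMap.quotKerEquivOfSurjective F.1 F.2).toEquiv]
    have hposK : 0 < Nat.card (ckP p (LinearMap.ker F.1)) := Nat.card_pos
    have h4 : Nat.card (ckP p U) =
        Nat.card (ckP p (LinearMap.ker F.1)) * Nat.card (ckP p G) * q ^ r := by
      apply Nat.eq_of_mul_eq_mul_left (show 0 < q ^ r by positivity)
      rw [hUcard, h3, h2, hGcard]; ring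
    apply Nat.eq_of_mul_eq_mul_left (pow_pos hposK r)
    rw [← mul_assoc _ B, ← h1, h4]
    ring
  apply Nat.eq_of_mul_eq_mul_right (pow_pos hposG r)
  rw [mul_assoc, mul_comm (q ^ r ^ 2), Finset.sum_mul, Finset.sum_congr rfl (fun F _ => key' F),
    Finset.sum_const, Finset.card_univ, smul_eq_mul, ← Nat.card_eq_fintype_card, hSur, hGgen,
    Nat.card_fun (α := Fin r) (β := U)]
  simp only [Nat.card_eq_fintype_card (α := Fin r), Fintype.card_fin]
  ring

end mod4


section ringfacts
open Polynomial
variable {p : ℕ} [Fact p.Prime] (P : ℤ_[p][X])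

lemma ck_R_irr (hm : P.Monic) (hirr : Irreducible (P.map (PadicInt.toZMod : ℤ_[p] →+* ZMod p))) :
    Irreducible P :=
  hm.irreducible_of_irreducible_map _ _ hirr

lemma ck_R_dom (hm : P.Monic) (hirr : Irreducible (P.map (PadicInt.toZMod : ℤ_[p] →+* ZMod p))) :
    IsDomain (AdjoinRoot P) := by
  have : Prime P := (ck_R_irr P hm hirr).prime
  exact AdjoinRoot.isDomain_of_prime this

/-- reduction map -/
noncomputable def ckRed : AdjoinRoot P →+* AdjoinRoot (P.map (PadicInt.toZMod : ℤ_[p] →+* ZMod p)) :=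
  AdjoinRoot.lift ((AdjoinRoot.of _).comp PadicInt.toZMod) (AdjoinRoot.root _) (by
    rw [← eval₂_map, AdjoinRoot.eval₂_root])

lemma ckRed_mk (f : ℤ_[p][X]) : ckRed P (AdjoinRoot.mk P f) = AdjoinRoot.mk _ (f.map PadicInt.toZMod) := by
  rw [ckRed, AdjoinRoot.lift_mk, ← eval₂_map, ← AdjoinRoot.aeval_eq]
  rfl

lemma ck_poly_dvd (f : ℤ_[p][X]) (hf : f.map (PadicInt.toZMod : ℤ_[p] →+* ZMod p) = 0) :
    ∃ g, f = (p : ℤ_[p][X]) * g := by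
  have : (C (p : ℤ_[p])) ∣ f := by
    rw [C_dvd_iff_dvd_coeff]
    intro i
    have h : PadicInt.toZMod (f.coeff i) = 0 := by
      rw [← coeff_map, hf, coeff_zero]
    rw [← RingHom.mem_ker, PadicInt.ker_toZMod, PadicInt.maximalIdeal_eq_span_p,
      Ideal.mem_span_singleton] at h
    exact h
  simpa [Dvd.dvd] using this

lemma ckRed_surj : Function.Surjective (ckRed P) := by
  intro x
  obtain ⟨f, rfl⟩ := AdjoinRoot.mk_surjective x
  obtain ⟨g, rfl⟩ := Polynomial.map_surjective _ (ZMod.ringHom_surjective (PadicInt.toZMod (p := p))) f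
  exact ⟨AdjoinRoot.mk P g, ckRed_mk P g⟩

lemma ckRed_ker : RingHom.ker (ckRed P) = Ideal.span {(p : AdjoinRoot P)} := by
  ext x
  obtain ⟨f, rfl⟩ := AdjoinRoot.mk_surjective x
  rw [RingHom.mem_ker, ckRed_mk, AdjoinRoot.mk_eq_zero, Ideal.mem_span_singleton]
  constructor
  · rintro ⟨g, hg⟩
    obtain ⟨g, rfl⟩ := Polynomial.map_surjective _ (ZMod.ringHom_surjective (PadicInt.toZMod (p := p))) g
    obtain ⟨h, hh⟩ := ck_poly_dvd (f - P * g) (by rw [Polynomial.map_sub, Polynomial.map_mul, hg, sub_self])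
    refine ⟨AdjoinRoot.mk P h, ?_⟩
    have := congrArg (AdjoinRoot.mk P) hh
    simpa using this
  · rintro ⟨g, hg⟩
    obtain ⟨g, rfl⟩ := AdjoinRoot.mk_surjective g
    rw [← AdjoinRoot.mk_eq_zero, ← ckRed_mk, hg]
    simp only [map_mul, map_natCast]
    have : (p : AdjoinRoot (P.map (PadicInt.toZMod : ℤ_[p] →+* ZMod p))) = 0 := by
      have := congrArg (AdjoinRoot.of (P.map (PadicInt.toZMod : ℤ_[p] →+* ZMod p))) (CharP.cast_eq_zero (ZMod p) p)
      rw [map_natCast, map_zero] at this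
      exact this
    rw [this, zero_mul]

lemma ck_R_max (hirr : Irreducible (P.map (PadicInt.toZMod : ℤ_[p] →+* ZMod p))) :
    (Ideal.span {(p : AdjoinRoot P)}).IsMaximal := by
  have := Fact.mk hirr
  rw [← ckRed_ker]
  exact RingHom.ker_isMaximal_of_surjective _ (ckRed_surj P)

lemma ck_R_card (hm : P.Monic) :
    Nat.card (AdjoinRoot P ⧸ Ideal.span {(p : AdjoinRoot P)}) = p ^ P.natDegree := by
  rw [← ckRed_ker, Nat.card_congr (RingHom.quotientKerEquivOfSurjective (ckRed_surj P)).toEquiv]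
  have hm' := hm.map (PadicInt.toZMod : ℤ_[p] →+* ZMod p)
  let b := AdjoinRoot.powerBasis' hm'
  rw [Nat.card_congr b.basis.equivFun.toEquiv, Nat.card_fun]
  simp [b, hm.natDegree_map]

lemma ck_R_p0 (hm : P.Monic) (hirr : Irreducible (P.map (PadicInt.toZMod : ℤ_[p] →+* ZMod p))) :
    (p : AdjoinRoot P) ≠ 0 := by
  intro h
  have h1 : AdjoinRoot.of P (p : ℤ_[p]) = 0 := by simpa using h
  have hd : P.degree ≠ 0 := by
    have := hirr.natDegree_pos
    rw [hm.natDegree_map] at this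
    intro h; have := natDegree_eq_zero_iff_degree_le_zero.2 h.le; omega
  have := (AdjoinRoot.of.injective_of_degree_ne_zero hd) (h1.trans (map_zero _).symm)
  exact (Nat.cast_ne_zero.2 (Fact.out : p.Prime).ne_zero) this

lemma ck_R_jac (hm : P.Monic) (I : Ideal (AdjoinRoot P)) (hI : I.IsMaximal) :
    (p : AdjoinRoot P) ∈ I := by
  have : Module.Finite ℤ_[p] (AdjoinRoot P) := hm.finite_adjoinRoot
  have h1 : (I.comap (algebraMap ℤ_[p] (AdjoinRoot P))).IsMaximal :=
    Ideal.isMaximal_comap_of_isIntegral_of_isMaximal I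
  have h2 := IsLocalRing.eq_maximalIdeal h1
  have h3 : (p : ℤ_[p]) ∈ I.comap (algebraMap ℤ_[p] (AdjoinRoot P)) := by
    rw [h2, PadicInt.maximalIdeal_eq_span_p]
    exact Ideal.mem_span_singleton_self _
  simpa using h3

lemma ck_R_noeth : IsNoetherianRing (AdjoinRoot P) :=
  inferInstance

lemma ck_R_pid (hm : P.Monic) (hirr : Irreducible (P.map (PadicInt.toZMod : ℤ_[p] →+* ZMod p))) :
    IsPrincipalIdealRing (AdjoinRoot P) := by
  have hmax := ck_R_max P hirr
  have := ck_R_dom P hm hirr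
  have := ck_R_noeth P
  have : IsLocalRing (AdjoinRoot P) := IsLocalRing.of_unique_max_ideal
    ⟨_, hmax, fun I hI => (hmax.eq_of_le hI.ne_top
      ((Ideal.span_singleton_le_iff_mem _).2 (ck_R_jac P hm I hI))).symm⟩
  have hmi := IsLocalRing.eq_maximalIdeal hmax
  have hnf : ¬ IsField (AdjoinRoot P) := by
    intro h
    have := IsLocalRing.isField_iff_maximalIdeal_eq.1 h
    rw [← hmi, Ideal.span_singleton_eq_bot] at this
    exact ck_R_p0 P hm hirr this
  have := (((tfae_of_isNoetherianRing_of_isLocalRing_of_isDomain (AdjoinRoot P)).out 0 4).2 ?_)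
  · exact this
  · rw [← hmi]; exact ⟨⟨_, rfl⟩⟩

end ringfacts


section crt
open Polynomial
variable {p : ℕ} [Fact p.Prime]

lemma ck_padic_nat (a : ℤ_[p]) : ∃ (m : ℕ) (b : ℤ_[p]), a = m + p * b := by
  have h := PadicInt.appr_spec 1 a
  rw [pow_one, Ideal.mem_span_singleton] at h
  obtain ⟨b, hb⟩ := h
  exact ⟨a.appr 1, b, by rw [← hb]; ring⟩

variable {J : Type} [Fintype J] (P : J → ℤ_[p][X])

lemma ck_idem [DecidableEq J] (hm : ∀ j, (P j).Monic)
    (hirr : ∀ j, Irreducible ((P j).map (PadicInt.toZMod : ℤ_[p] →+* ZMod p)))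
    (hdist : ∀ j k, j ≠ k → (P j).map (PadicInt.toZMod : ℤ_[p] →+* ZMod p) ≠
      (P k).map (PadicInt.toZMod : ℤ_[p] →+* ZMod p)) (j : J) :
    ∃ e : ℤ_[p][X], ∀ i, ∃ b : AdjoinRoot (P i),
      AdjoinRoot.mk (P i) e = (if i = j then 1 else 0) + (p : AdjoinRoot (P i)) * b := by
  have hcop : Pairwise fun i k => IsCoprime
      (Ideal.span {(P i).map (PadicInt.toZMod : ℤ_[p] →+* ZMod p)})
      (Ideal.span {(P k).map (PadicInt.toZMod : ℤ_[p] →+* ZMod p)}) := by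
    intro i k hik
    rw [Ideal.isCoprime_span_singleton_iff, (hirr i).coprime_iff_not_dvd]
    intro hd
    exact hdist i k hik (eq_of_monic_of_associated ((hm i).map _) ((hm k).map _)
      ((hirr i).associated_of_dvd (hirr k) hd))
  obtain ⟨e, he⟩ := Ideal.exists_forall_sub_mem_ideal
    (I := fun i => Ideal.span {(P i).map (PadicInt.toZMod : ℤ_[p] →+* ZMod p)}) hcop (fun i => if i = j then 1 else 0)
  obtain ⟨e, rfl⟩ := Polynomial.map_surjective _ (ZMod.ringHom_surjective (PadicInt.toZMod (p := p))) e
  refine ⟨e, fun i => ?_⟩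
  have h := he i
  rw [Ideal.mem_span_singleton, ← AdjoinRoot.mk_eq_zero, map_sub, ← ckRed_mk] at h
  have h2 : AdjoinRoot.mk (P i) e - (if i = j then 1 else 0) ∈ RingHom.ker (ckRed (P i)) := by
    rw [RingHom.mem_ker, map_sub, ← h]
    split_ifs <;> simp
  rw [ckRed_ker, Ideal.mem_span_singleton] at h2
  obtain ⟨b, hb⟩ := h2
  exact ⟨b, by rw [← hb]; ring⟩

/-- matrix `X - t` -/
noncomputable def ckA {n : ℕ} (Q : ℤ_[p][X]) (X0 : Fin n → Fin n → ℤ_[p]) (k i : Fin n) : AdjoinRoot Q :=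
  algebraMap ℤ_[p] (AdjoinRoot Q) (X0 k i) - if k = i then AdjoinRoot.root Q else 0

lemma ckA_lin {n : ℕ} (Q : ℤ_[p][X]) (X0 : Fin n → Fin n → ℤ_[p]) {G : Type} [AddCommGroup G]
    [Module (AdjoinRoot Q) G] (f : Fin n → G) (i : Fin n) :
    Fintype.linearCombination (AdjoinRoot Q) f (fun k => ckA Q X0 k i) =
      ∑ k, algebraMap ℤ_[p] (AdjoinRoot Q) (X0 k i) • f k - AdjoinRoot.root Q • f i := by
  rw [Fintype.linearCombination_apply]
  simp only [ckA, sub_smul, Finset.sum_sub_distrib, ite_smul, zero_smul]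
  simp

lemma ck_crt (hm : ∀ j, (P j).Monic)
    (hirr : ∀ j, Irreducible ((P j).map (PadicInt.toZMod : ℤ_[p] →+* ZMod p)))
    (hdist : ∀ j k, j ≠ k → (P j).map (PadicInt.toZMod : ℤ_[p] →+* ZMod p) ≠
      (P k).map (PadicInt.toZMod : ℤ_[p] →+* ZMod p))
    (G : J → Type) [∀ j, AddCommGroup (G j)] [∀ j, Module (AdjoinRoot (P j)) (G j)]
    (N : ℕ) (hN : ∀ j (x : G j), p ^ N • x = 0) {n : ℕ} (X0 : Fin n → Fin n → ℤ_[p])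
    (f : ∀ j, Fin n → G j)
    (hgen : ∀ j, Submodule.span (AdjoinRoot (P j)) (Set.range (f j)) = ⊤)
    (hrel : ∀ j i, Fintype.linearCombination (AdjoinRoot (P j)) (f j)
      (fun k => ckA (P j) X0 k i) ∈ ckP p (G j)) :
    AddSubgroup.closure (Set.range fun k : Fin n => fun j => f j k) = ⊤ := by
  classical
  set I := AddSubgroup.closure (Set.range fun k : Fin n => fun j => f j k) with hI
  apply ck_nakayama p N (fun x => funext fun j => hN j (x j))
  let I' : AddSubgroup (∀ j, G j) := I ⊔ ckP p (∀ j, G j)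
  suffices hT : ∀ x, x ∈ I' by
    intro x
    obtain ⟨y, hy, z, ⟨z, rfl⟩, h⟩ := AddSubgroup.mem_sup.1 (hT x)
    exact ⟨y, hy, z, h.symm⟩
  let act : ℤ_[p][X] → (∀ j, G j) →+ (∀ j, G j) := fun g =>
    { toFun := fun x j => AdjoinRoot.mk (P j) g • x j
      map_zero' := by ext; simp
      map_add' := by intros; ext; simp }
  have hpI : ∀ x, p • x ∈ I' := fun x => AddSubgroup.mem_sup_right ⟨x, rfl⟩
  have hC : ∀ a : ℤ_[p], ∀ x ∈ I', act (C a) x ∈ I' := by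
    intro a x hx
    obtain ⟨m, b, rfl⟩ := ck_padic_nat a
    have : act (C ((m : ℤ_[p]) + p * b)) x = m • x + p • act (C b) x := by
      ext j
      simp only [act, AddMonoidHom.coe_mk, ZeroHom.coe_mk, Pi.add_apply, Pi.smul_apply, map_add,
        map_mul, map_natCast, add_smul, mul_smul, Nat.cast_smul_eq_nsmul]
    rw [this]
    exact I'.add_mem (I'.nsmul_mem hx _) (hpI _)
  have hX : ∀ x ∈ I', act X x ∈ I' := by
    have h1 : I' ≤ I'.comap (act X) := by
      refine sup_le ?_ ?_
      · rw [hI, AddSubgroup.closure_le]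
        rintro _ ⟨i, rfl⟩
        choose z hz using fun j => ck_mem_ckP.1 (hrel j i)
        have : act X (fun j => f j i) =
            ∑ k, act (C (X0 k i)) (fun j => f j k) - p • z := by
          ext j
          have h := hz j
          rw [ckA_lin] at h
          rw [Pi.sub_apply, Pi.smul_apply, h, Finset.sum_apply]
          simp only [act, AddMonoidHom.coe_mk, ZeroHom.coe_mk, AdjoinRoot.mk_X, AdjoinRoot.mk_C,
            AdjoinRoot.algebraMap_eq]
          abel
        change act X (fun j => f j i) ∈ I'
        rw [this]
        refine I'.sub_mem (AddSubgroup.sum_mem _ fun k _ => hC _ _ ?_) (hpI _)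
        exact AddSubgroup.mem_sup_left (AddSubgroup.subset_closure ⟨k, rfl⟩)
      · rintro _ ⟨x, rfl⟩
        change act X (p • x) ∈ I'
        rw [map_nsmul]
        exact hpI _
    exact h1
  have hact : ∀ g : ℤ_[p][X], ∀ x ∈ I', act g x ∈ I' := by
    intro g
    induction g using Polynomial.induction_on with
    | C a => exact hC a
    | add g h hg hh =>
      intro x hx
      have : act (g + h) x = act g x + act h x := by
        ext j; simp [act, add_smul]
      rw [this]
      exact I'.add_mem (hg x hx) (hh x hx)
    | monomial m a ih =>
      intro x hx
      have : act (C a * X ^ (m + 1)) x = act (C a * X ^ m) (act X x) := by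
        ext j
        simp only [act, AddMonoidHom.coe_mk, ZeroHom.coe_mk, smul_smul, ← map_mul]
        rw [pow_succ, mul_assoc]
      rw [this]
      exact ih _ (hX x hx)
  have hsingle : ∀ j (u : G j), Pi.single j u ∈ I' := by
    intro j u
    obtain ⟨e, he⟩ := ck_idem P hm hirr hdist j
    choose b hb using he
    have hu : u ∈ Submodule.span (AdjoinRoot (P j)) (Set.range (f j)) := by rw [hgen]; trivial
    induction hu using Submodule.span_induction with
    | mem u hu =>
      obtain ⟨k, rfl⟩ := hu
      have : Pi.single j (f j k) = act e (fun i => f i k) - p • fun i => b i • f i k := by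
        ext i
        rw [Pi.sub_apply, Pi.smul_apply]
        simp only [act, AddMonoidHom.coe_mk, ZeroHom.coe_mk]
        rw [hb i, add_smul, mul_smul, Nat.cast_smul_eq_nsmul, add_sub_cancel_right]
        by_cases h : i = j
        · subst h; simp
        · simp [h]
      rw [this]
      exact I'.sub_mem (hact _ _ (AddSubgroup.mem_sup_left (AddSubgroup.subset_closure ⟨k, rfl⟩)))
        (hpI _)
    | zero => rw [Pi.single_zero]; exact I'.zero_mem
    | add x y _ _ hx hy => rw [Pi.single_add]; exact I'.add_mem hx hy
    | smul a x _ hx =>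
      obtain ⟨g, rfl⟩ := AdjoinRoot.mk_surjective a
      have : Pi.single j (AdjoinRoot.mk (P j) g • x) = act g (Pi.single j x) := by
        ext i
        simp only [act, AddMonoidHom.coe_mk, ZeroHom.coe_mk]
        by_cases h : i = j
        · subst h; simp
        · simp [h]
      rw [this]
      exact hact _ _ hx
  intro x
  rw [← Finset.univ_sum_single x]
  exact AddSubgroup.sum_mem _ fun j _ => hsingle j _

end crt


section model1
open Polynomial

lemma ckP_pi_card (p : ℕ) {J : Type} [Fintype J] (G : J → Type) [∀ j, AddCommGroup (G j)] :
    Nat.card (ckP p (∀ j, G j)) = ∏ j, Nat.card (ckP p (G j)) := by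
  rw [← Nat.card_pi]
  refine Nat.card_congr ((Equiv.subtypeEquivRight fun x => ?_).trans
    (Equiv.subtypePiEquivPi (p := fun j (x : G j) => x ∈ ckP p (G j))))
  constructor
  · rintro ⟨y, rfl⟩ j
    exact ⟨y j, rfl⟩
  · intro h
    choose y hy using h
    exact ⟨y, funext hy⟩

variable {p : ℕ} [Fact p.Prime]

/-- perturbation of a matrix -/
noncomputable def ckLift {M n : ℕ} (X0 : Fin n → Fin n → ℤ_[p]) (Y : Fin n → Fin n → ZMod (p ^ M))
    (k i : Fin n) : ℤ_[p] := X0 k i + p * ((Y k i).val : ℤ_[p])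

lemma ckLift_lin {M n : ℕ} (Q : ℤ_[p][X]) (X0 : Fin n → Fin n → ℤ_[p])
    (Y : Fin n → Fin n → ZMod (p ^ M)) {G : Type} [AddCommGroup G]
    [Module (AdjoinRoot Q) G] (f : Fin n → G) (i : Fin n) :
    Fintype.linearCombination (AdjoinRoot Q) f (fun k => ckA Q (ckLift X0 Y) k i) =
      Fintype.linearCombination (AdjoinRoot Q) f (fun k => ckA Q X0 k i) +
        p • ∑ k, (Y k i).val • f k := by
  rw [ckA_lin, ckA_lin]
  simp only [ckLift, map_add, map_mul, map_natCast, add_smul, mul_smul, Nat.cast_smul_eq_nsmul,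
    Finset.sum_add_distrib, Finset.smul_sum]
  abel

variable {J : Type} [Fintype J] (P : J → ℤ_[p][X])

lemma ck_count_Y (hm : ∀ j, (P j).Monic)
    (hirr : ∀ j, Irreducible ((P j).map (PadicInt.toZMod : ℤ_[p] →+* ZMod p)))
    (hdist : ∀ j k, j ≠ k → (P j).map (PadicInt.toZMod : ℤ_[p] →+* ZMod p) ≠
      (P k).map (PadicInt.toZMod : ℤ_[p] →+* ZMod p))
    (G : J → Type) [∀ j, AddCommGroup (G j)] [∀ j, Module (AdjoinRoot (P j)) (G j)]
    [∀ j, Finite (G j)]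
    (M : ℕ) (hN : ∀ j (x : G j), p ^ M • x = 0) {n : ℕ} (X0 : Fin n → Fin n → ℤ_[p])
    (f : ∀ j, Fin n → G j)
    (hgen : ∀ j, Submodule.span (AdjoinRoot (P j)) (Set.range (f j)) = ⊤)
    (hrel : ∀ j i, Fintype.linearCombination (AdjoinRoot (P j)) (f j)
      (fun k => ckA (P j) X0 k i) ∈ ckP p (G j)) :
    Nat.card {Y : Fin n → Fin n → ZMod (p ^ M) // ∀ j i,
      Fintype.linearCombination (AdjoinRoot (P j)) (f j)
        (fun k => ckA (P j) (ckLift X0 Y) k i) = 0} * (∏ j, Nat.card (ckP p (G j))) ^ n =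
      Nat.card (Fin n → Fin n → ZMod (p ^ M)) := by
  have hne : NeZero (p ^ M) := ⟨pow_ne_zero _ (Fact.out : p.Prime).ne_zero⟩
  let : Module (ZMod (p ^ M)) (∀ j, G j) :=
    AddCommGroup.zmodModule (fun x => funext fun j => hN j (x j))
  let F : Fin n → ∀ j, G j := fun k j => f j k
  let φ : (Fin n → ZMod (p ^ M)) →+ ∀ j, G j :=
    { toFun := fun y => ∑ k, y k • F k
      map_zero' := by simp
      map_add' := by intros; simp [add_smul, Finset.sum_add_distrib] }
  have hφ : ∀ y j, φ y j = ∑ k, (y k).val • f j k := by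
    intro y j
    change (∑ k, y k • F k) j = _
    rw [Finset.sum_apply]
    refine Finset.sum_congr rfl fun k _ => ?_
    conv_lhs => rw [← ZMod.natCast_zmod_val (y k), Nat.cast_smul_eq_nsmul]
    rfl
  have hsurj : Function.Surjective φ := by
    rw [← AddMonoidHom.range_eq_top, eq_top_iff, ← ck_crt P hm hirr hdist G M hN X0 f hgen hrel,
      AddSubgroup.closure_le]
    rintro _ ⟨k, rfl⟩
    refine ⟨Pi.single k 1, ?_⟩
    change ∑ i, (Pi.single k 1 : Fin n → ZMod (p ^ M)) i • F i = F k
    rw [Finset.sum_eq_single k (fun i _ hi => by rw [Pi.single_eq_of_ne hi, zero_smul])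
      (fun h => absurd (Finset.mem_univ _) h), Pi.single_eq_same, one_smul]
  have h := ck_card_tuple p φ hsurj (r := n)
    (fun i j => - Fintype.linearCombination (AdjoinRoot (P j)) (f j) (fun k => ckA (P j) X0 k i))
    (by
      intro i
      choose z hz using fun j => ck_mem_ckP.1 (hrel j i)
      exact ⟨fun j => - z j, funext fun j => by
        change p • (- z j) = _
        rw [smul_neg, hz]⟩)
  rw [ckP_pi_card] at h
  rw [Nat.card_fun (α := Fin n) (β := Fin n → ZMod (p ^ M)), Nat.card_eq_fintype_card (α := Fin n),
    Fintype.card_fin, ← h]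
  congr 1
  refine Nat.card_congr (Equiv.subtypeEquiv (Equiv.piComm _) fun Y => ?_)
  rw [forall_comm]
  refine forall_congr' fun i => ?_
  rw [funext_iff]
  refine forall_congr' fun j => ?_
  rw [ckLift_lin, Pi.smul_apply, hφ, eq_neg_iff_add_eq_zero, add_comm]
  rfl

lemma ck_m1_moment (hm : ∀ j, (P j).Monic)
    (hirr : ∀ j, Irreducible ((P j).map (PadicInt.toZMod : ℤ_[p] →+* ZMod p)))
    (hdist : ∀ j k, j ≠ k → (P j).map (PadicInt.toZMod : ℤ_[p] →+* ZMod p) ≠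
      (P k).map (PadicInt.toZMod : ℤ_[p] →+* ZMod p))
    (G : J → Type) [∀ j, AddCommGroup (G j)] [∀ j, Module (AdjoinRoot (P j)) (G j)]
    [∀ j, Finite (G j)] (q r : J → ℕ) (hq : ∀ j, q j = p ^ (P j).natDegree)
    (M : ℕ) (hN : ∀ j (x : G j), p ^ M • x = 0) {n : ℕ} (X0 : Fin n → Fin n → ℤ_[p])
    (hD : ∀ j, Nat.card ((Fin n → AdjoinRoot (P j)) ⧸ ckK (ckA (P j) X0) (p : AdjoinRoot (P j)))
      = q j ^ r j) [Fintype (Fin n → Fin n → ZMod (p ^ M))] :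
    ∑ Y : Fin n → Fin n → ZMod (p ^ M), ∏ j, ckSur (AdjoinRoot (P j))
      ((Fin n → AdjoinRoot (P j)) ⧸ ckK (ckA (P j) (ckLift X0 Y)) ((p : AdjoinRoot (P j)) ^ M)) (G j)
      = Nat.card (Fin n → Fin n → ZMod (p ^ M)) *
        ∏ j, ckGen (AdjoinRoot (P j))
          (G j ⧸ ((p : AdjoinRoot (P j)) • (⊤ : Submodule (AdjoinRoot (P j)) (G j)))) (r j) := by
  classical
  let good : (∀ j, Fin n → G j) → (Fin n → Fin n → ZMod (p ^ M)) → Prop := fun f Y =>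
    ∀ j, Submodule.span (AdjoinRoot (P j)) (Set.range (f j)) = ⊤ ∧
      ∀ i, Fintype.linearCombination (AdjoinRoot (P j)) (f j)
        (fun k => ckA (P j) (ckLift X0 Y) k i) = 0
  let good0 : (∀ j, Fin n → G j) → Prop := fun f =>
    ∀ j, Submodule.span (AdjoinRoot (P j)) (Set.range (f j)) = ⊤ ∧
      ∀ i, Fintype.linearCombination (AdjoinRoot (P j)) (f j)
        (fun k => ckA (P j) X0 k i) ∈ ckP p (G j)
  have h1 : ∀ Y : Fin n → Fin n → ZMod (p ^ M), ∏ j, ckSur (AdjoinRoot (P j))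
      ((Fin n → AdjoinRoot (P j)) ⧸ ckK (ckA (P j) (ckLift X0 Y)) ((p : AdjoinRoot (P j)) ^ M)) (G j)
      = Nat.card {f // good f Y} := by
    intro Y
    rw [Nat.card_congr (Equiv.subtypePiEquivPi (p := fun j (f : Fin n → G j) =>
      Submodule.span (AdjoinRoot (P j)) (Set.range f) = ⊤ ∧
      ∀ i, Fintype.linearCombination (AdjoinRoot (P j)) f
        (fun k => ckA (P j) (ckLift X0 Y) k i) = 0)), Nat.card_pi]
    refine Finset.prod_congr rfl fun j _ => ?_
    apply ckSur_K
    intro x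
    rw [← Nat.cast_pow, Nat.cast_smul_eq_nsmul, hN]
  let := Fintype.ofFinite (∀ j, Fin n → G j)
  rw [Finset.sum_congr rfl (fun Y _ => h1 Y), ck_sum_card_comm (fun Y f => good f Y)]
  have hpos : 0 < (∏ j, Nat.card (ckP p (G j))) ^ n :=
    pow_pos (Finset.prod_pos fun j _ => Nat.card_pos) _
  apply Nat.eq_of_mul_eq_mul_right hpos
  have h2 : ∀ f, Nat.card {Y // good f Y} * (∏ j, Nat.card (ckP p (G j))) ^ n =
      if good0 f then Nat.card (Fin n → Fin n → ZMod (p ^ M)) else 0 := by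
    intro f
    split_ifs with h
    · rw [← ck_count_Y P hm hirr hdist G M hN X0 f (fun j => (h j).1) (fun j => (h j).2)]
      congr 1
      exact Nat.card_congr (Equiv.subtypeEquivRight fun Y => forall_congr' fun j =>
        and_iff_right (h j).1)
    · have : IsEmpty {Y // good f Y} := by
        refine ⟨fun Y => h fun j => ⟨(Y.2 j).1, fun i => ?_⟩⟩
        have h3 := (Y.2 j).2 i
        rw [ckLift_lin, add_eq_zero_iff_eq_neg] at h3
        rw [h3]
        exact neg_mem ⟨_, rfl⟩
      rw [Nat.card_of_isEmpty, zero_mul]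
  rw [Finset.sum_mul, Finset.sum_congr rfl (fun f _ => h2 f), ← Finset.sum_filter,
    Finset.sum_const, smul_eq_mul, ← Fintype.card_subtype, ← Nat.card_eq_fintype_card]
  have h4 : Nat.card {f // good0 f} = ∏ j, (Nat.card (ckP p (G j)) ^ n * ckGen (AdjoinRoot (P j))
          (G j ⧸ ((p : AdjoinRoot (P j)) • (⊤ : Submodule (AdjoinRoot (P j)) (G j)))) (r j)) := by
    rw [Nat.card_congr (Equiv.subtypePiEquivPi (p := fun j (f : Fin n → G j) =>
      Submodule.span (AdjoinRoot (P j)) (Set.range f) = ⊤ ∧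
      ∀ i, Fintype.linearCombination (AdjoinRoot (P j)) f
        (fun k => ckA (P j) X0 k i) ∈ ckP p (G j))), Nat.card_pi]
    refine Finset.prod_congr rfl fun j _ => ?_
    rw [ckGen_rel_quot p M (hN j)]
    congr 1
    have hk : ∀ x : G j ⧸ ((p : AdjoinRoot (P j)) • (⊤ : Submodule (AdjoinRoot (P j)) (G j))),
        (p : AdjoinRoot (P j)) • x = 0 := fun x => by
      rw [Nat.cast_smul_eq_nsmul, ck_quot_killed]
    rw [← ckSur_K (ckA (P j) X0) (p : AdjoinRoot (P j)) hk]
    have hqj : 1 < q j := by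
      rw [hq]
      apply Nat.one_lt_pow
      · have := (hirr j).natDegree_pos
        rw [(hm j).natDegree_map] at this
        omega
      · exact (Fact.out : p.Prime).one_lt
    have hfin : Finite ((Fin n → AdjoinRoot (P j)) ⧸ ckK (ckA (P j) X0) (p : AdjoinRoot (P j))) := by
      apply Nat.finite_of_card_ne_zero
      rw [hD]; positivity
    obtain ⟨e⟩ := (ck_field_stuff p (q j) (ck_R_max (P j) (hirr j))
      ((ck_R_card (P j) (hm j)).trans (hq j).symm) hqj
      (H := (Fin n → AdjoinRoot (P j)) ⧸ ckK (ckA (P j) X0) (p : AdjoinRoot (P j)))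
      (fun x => by rw [← Nat.cast_smul_eq_nsmul (AdjoinRoot (P j)), ckK_smul]) (hD j)).1
    rw [ckSur_congr e, ckSur_free]
    intro a ha x
    obtain ⟨b, rfl⟩ := Ideal.mem_span_singleton.1 ha
    rw [mul_comm, mul_smul, hk, smul_zero]
  rw [h4, Finset.prod_mul_distrib, Finset.prod_pow]
  ring

end model1


section comb
open Polynomial

lemma ck_B (q r : ℕ) (hq : 1 < q) : ((∏ i : Fin r, (q ^ r - q ^ (i : ℕ)) : ℕ) : ℝ) =
    (q : ℝ) ^ (r ^ 2) * ∏ i ∈ Finset.Icc 1 r, (1 - (q : ℝ)⁻¹ ^ i) := by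
  have hq0 : (q : ℝ) ≠ 0 := by positivity
  rw [Nat.cast_prod]
  have h1 : ∀ i : Fin r, ((q ^ r - q ^ (i : ℕ) : ℕ) : ℝ) = (q : ℝ) ^ r * (1 - (q : ℝ)⁻¹ ^ (r - (i : ℕ))) := by
    intro i
    have hi := i.2.le
    rw [Nat.cast_sub (Nat.pow_le_pow_right (by omega) hi)]
    push_cast
    have : (q : ℝ) ^ r = q ^ (i : ℕ) * q ^ (r - (i : ℕ)) := by rw [← pow_add]; congr 1; omega
    rw [this, inv_pow]
    field_simp
  rw [Finset.prod_congr rfl (fun i _ => h1 i), Finset.prod_mul_distrib, Finset.prod_const,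
    Finset.card_univ, Fintype.card_fin, ← pow_mul, ← sq]
  congr 1
  rw [Fin.prod_univ_eq_prod_range (fun i => 1 - (q : ℝ)⁻¹ ^ (r - i)) r]
  refine Finset.prod_nbij' (fun i => r - i) (fun i => r - i) ?_ ?_ ?_ ?_ ?_
  all_goals intro a ha; simp only [Finset.mem_range, Finset.mem_Icc] at *
  all_goals omega

lemma ck_unique2 {J : Type} [Fintype J] (R : J → Type) [∀ j, CommRing (R j)] (p N : ℕ)
    {Ω1 Ω2 : Type} [Fintype Ω1] [Fintype Ω2] (C1 : Ω1 → J → Type) (C2 : Ω2 → J → Type)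
    [a1 : ∀ ω j, AddCommGroup (C1 ω j)] [b1 : ∀ ω j, Module (R j) (C1 ω j)]
    [c1 : ∀ ω j, Finite (C1 ω j)]
    [a2 : ∀ ω j, AddCommGroup (C2 ω j)] [b2 : ∀ ω j, Module (R j) (C2 ω j)]
    [c2 : ∀ ω j, Finite (C2 ω j)]
    (hC1 : ∀ ω j (x : C1 ω j), p ^ N • x = 0) (hC2 : ∀ ω j (x : C2 ω j), p ^ N • x = 0)
    (hmom : ∀ (G : J → Type) [∀ j, AddCommGroup (G j)] [∀ j, Module (R j) (G j)]
      [∀ j, Finite (G j)], (∀ j (x : G j), p ^ N • x = 0) →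
      Nat.card Ω2 * ∑ ω, (∏ j, ckSur (R j) (C1 ω j) (G j)) =
      Nat.card Ω1 * ∑ ω, (∏ j, ckSur (R j) (C2 ω j) (G j)))
    (G : J → Type) [∀ j, AddCommGroup (G j)] [∀ j, Module (R j) (G j)] [∀ j, Finite (G j)]
    (hG : ∀ j (x : G j), p ^ N • x = 0) :
    Nat.card Ω2 * Nat.card {ω // ∀ j, Nonempty (C1 ω j ≃ₗ[R j] G j)} =
    Nat.card Ω1 * Nat.card {ω // ∀ j, Nonempty (C2 ω j ≃ₗ[R j] G j)} := by
  classical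
  let C : Ω1 ⊕ Ω2 → J → Type := Sum.elim C1 C2
  let i1 : ∀ ω j, AddCommGroup (C ω j) := fun ω => Sum.rec
    (fun a j => a1 a j)
    (fun a j => a2 a j) ω
  let i2 : ∀ ω j, Module (R j) (C ω j) := fun ω => Sum.rec
    (fun a j => b1 a j)
    (fun a j => b2 a j) ω
  let i3 : ∀ ω j, Finite (C ω j) := fun ω => Sum.rec
    (fun a j => c1 a j)
    (fun a j => c2 a j) ω
  have h := ck_unique R p N (Sum.elim (fun _ => (Nat.card Ω2 : ℝ)) (fun _ => -(Nat.card Ω1 : ℝ))) C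
    (fun ω => Sum.rec (fun a j x => hC1 a j x) (fun a j x => hC2 a j x) ω)
    (by
      intro G _ _ _ hG
      rw [Fintype.sum_sum_type]
      simp only [Sum.elim_inl, Sum.elim_inr]
      rw [← Finset.mul_sum, ← Finset.mul_sum, ← Nat.cast_sum, ← Nat.cast_sum]
      have := congrArg (Nat.cast : ℕ → ℝ) (hmom G hG)
      rw [Nat.cast_mul, Nat.cast_mul] at this
      rw [neg_mul, ← sub_eq_add_neg, sub_eq_zero]
      exact this) G hG
  rw [Finset.sum_filter, Fintype.sum_sum_type] at h
  simp only [Sum.elim_inl, Sum.elim_inr] at h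
  rw [← Finset.sum_filter, ← Finset.sum_filter, Finset.sum_const, Finset.sum_const,
    ← Fintype.card_subtype, ← Fintype.card_subtype, ← Nat.card_eq_fintype_card,
    ← Nat.card_eq_fintype_card] at h
  simp only [nsmul_eq_mul] at h
  have h' : (Nat.card {ω // ∀ j, Nonempty (C1 ω j ≃ₗ[R j] G j)} : ℝ) * Nat.card Ω2 +
    (Nat.card {ω // ∀ j, Nonempty (C2 ω j ≃ₗ[R j] G j)} : ℝ) * (-(Nat.card Ω1 : ℝ)) = 0 := h
  have h'' : (Nat.card Ω2 : ℝ) * Nat.card {ω // ∀ j, Nonempty (C1 ω j ≃ₗ[R j] G j)} =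
    Nat.card Ω1 * Nat.card {ω // ∀ j, Nonempty (C2 ω j ≃ₗ[R j] G j)} := by linarith
  exact_mod_cast h''

lemma ck_finite_K {R : Type} [CommRing R] {n : ℕ} (A : Fin n → Fin n → R) (c : R)
    [Finite (R ⧸ Ideal.span {c})] : Finite ((Fin n → R) ⧸ ckK A c) := by
  refine Finite.of_surjective (fun w : Fin n → R ⧸ Ideal.span {c} =>
    (Submodule.Quotient.mk (fun i => Quotient.out (w i)) : (Fin n → R) ⧸ ckK A c)) ?_
  intro x
  obtain ⟨v, rfl⟩ := Submodule.Quotient.mk_surjective _ x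
  refine ⟨fun i => Ideal.Quotient.mk _ (v i), ?_⟩
  have h : ∀ i, ∃ d, Quotient.out (Ideal.Quotient.mk (Ideal.span {c}) (v i)) - v i = c * d := by
    intro i
    have : Ideal.Quotient.mk (Ideal.span {c}) (Quotient.out (Ideal.Quotient.mk (Ideal.span {c}) (v i)))
        = Ideal.Quotient.mk (Ideal.span {c}) (v i) := Quotient.out_eq _
    rw [Ideal.Quotient.eq, Ideal.mem_span_singleton] at this
    exact this
  choose d hd using h
  rw [← sub_eq_zero, ← Submodule.Quotient.mk_sub]
  have h2 : ((fun i => Quotient.out (Ideal.Quotient.mk (Ideal.span {c}) (v i))) - v) = c • d := by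
    ext i; rw [Pi.sub_apply, hd]; rfl
  rw [h2, Submodule.Quotient.mk_smul, ckK_smul]

variable {p : ℕ} [Fact p.Prime] {J : Type} [Fintype J] (P : J → ℤ_[p][X])

lemma ck_combine (hm : ∀ j, (P j).Monic)
    (hirr : ∀ j, Irreducible ((P j).map (PadicInt.toZMod : ℤ_[p] →+* ZMod p)))
    (hdist : ∀ j k, j ≠ k → (P j).map (PadicInt.toZMod : ℤ_[p] →+* ZMod p) ≠
      (P k).map (PadicInt.toZMod : ℤ_[p] →+* ZMod p))
    (G : J → Type) [∀ j, AddCommGroup (G j)] [∀ j, Module (AdjoinRoot (P j)) (G j)]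
    [∀ j, Finite (G j)] (q r : J → ℕ) (hq : ∀ j, q j = p ^ (P j).natDegree)
    (hr : ∀ j, Nat.card ((G j) ⧸ ((p : AdjoinRoot (P j)) •
        (⊤ : Submodule (AdjoinRoot (P j)) (G j)))) = q j ^ r j)
    (N : ℕ) (hN : ∀ j (x : G j), p ^ N • x = 0) {n : ℕ} (X0 : Fin n → Fin n → ℤ_[p])
    (hD : ∀ j, Nat.card ((Fin n → AdjoinRoot (P j)) ⧸ ckK (ckA (P j) X0) (p : AdjoinRoot (P j)))
      = q j ^ r j) :
    (Nat.card {Y : Fin n → Fin n → ZMod (p ^ (N + 1)) // ∀ j, Nonempty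
      (((Fin n → AdjoinRoot (P j)) ⧸ ckK (ckA (P j) (ckLift X0 Y)) ((p : AdjoinRoot (P j)) ^ (N + 1)))
        ≃ₗ[AdjoinRoot (P j)] G j)} : ℝ) =
      Nat.card (Fin n → Fin n → ZMod (p ^ (N + 1))) *
      ∏ j, (q j : ℝ) ^ (r j ^ 2) *
          (∏ i ∈ Finset.Icc 1 (r j), (1 - (q j : ℝ)⁻¹ ^ i) ^ 2) /
          (Nat.card (G j ≃ₗ[AdjoinRoot (P j)] G j) : ℝ) := by
  classical
  have hqj : ∀ j, 1 < q j := by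
    intro j
    rw [hq]
    apply Nat.one_lt_pow
    · have := (hirr j).natDegree_pos
      rw [(hm j).natDegree_map] at this
      omega
    · exact (Fact.out : p.Prime).one_lt
  have hdom := fun j => ck_R_dom (P j) (hm j) (hirr j)
  have hpid := fun j => ck_R_pid (P j) (hm j) (hirr j)
  have hmax := fun j => ck_R_max (P j) (hirr j)
  have hcard := fun j => (ck_R_card (P j) (hm j)).trans (hq j).symm
  have hp0 := fun j => ck_R_p0 (P j) (hm j) (hirr j)
  have hfin : ∀ j, Finite (AdjoinRoot (P j) ⧸ Ideal.span {(p : AdjoinRoot (P j)) ^ (N + 1)}) := by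
    intro j
    apply Nat.finite_of_card_ne_zero
    rw [ck_card_pow p (q j) (hp0 j) (hmax j) (hcard j)]
    have := hqj j
    positivity
  have hne : NeZero (p ^ (N + 1)) := ⟨pow_ne_zero _ (Fact.out : p.Prime).ne_zero⟩
  have hfK := fun j (Y : Fin n → Fin n → ZMod (p ^ (N + 1))) =>
    ck_finite_K (ckA (P j) (ckLift X0 Y)) ((p : AdjoinRoot (P j)) ^ (N + 1))
  let Ω2 := ∀ j, Fin (r j) → Fin (r j) → AdjoinRoot (P j) ⧸ Ideal.span {(p : AdjoinRoot (P j)) ^ (N + 1)}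
  let := fun j => Fintype.ofFinite (Fin (r j) → Fin (r j) →
    AdjoinRoot (P j) ⧸ Ideal.span {(p : AdjoinRoot (P j)) ^ (N + 1)})
  have hfC2 : ∀ (z : Ω2) j, Finite (ckC2 (R := AdjoinRoot (P j)) p (z j)) := fun z j =>
    Finite.of_surjective _ (Submodule.mkQ_surjective _)
  have hN' : ∀ j (x : G j), p ^ (N + 1) • x = 0 := fun j x => by
    rw [pow_succ, mul_comm, mul_smul, hN, smul_zero]
  have h := ck_unique2 (fun j => AdjoinRoot (P j)) p (N + 1)
    (fun (Y : Fin n → Fin n → ZMod (p ^ (N + 1))) j =>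
      (Fin n → AdjoinRoot (P j)) ⧸ ckK (ckA (P j) (ckLift X0 Y)) ((p : AdjoinRoot (P j)) ^ (N + 1)))
    (fun (z : Ω2) j => ckC2 (R := AdjoinRoot (P j)) p (z j))
    (fun Y j x => by
      rw [← Nat.cast_smul_eq_nsmul (AdjoinRoot (P j)), Nat.cast_pow, ckK_smul])
    (fun z j x => by
      obtain ⟨x, rfl⟩ := Submodule.Quotient.mk_surjective _ x
      rw [← Submodule.Quotient.mk_smul]
      refine (congrArg Submodule.Quotient.mk ?_).trans (Submodule.Quotient.mk_zero _)
      ext i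
      obtain ⟨a, ha⟩ := Ideal.Quotient.mk_surjective (x i)
      rw [Pi.smul_apply, ← ha, ← map_nsmul, Pi.zero_apply, Ideal.Quotient.eq_zero_iff_mem,
        Ideal.mem_span_singleton, nsmul_eq_mul]
      push_cast
      exact dvd_mul_right _ _)
    (by
      intro G _ _ _ hG
      rw [ck_m1_moment P hm hirr hdist G q r hq (N + 1) hG X0 hD]
      have h2 : ∑ z : Ω2, ∏ j, ckSur (AdjoinRoot (P j)) (ckC2 (R := AdjoinRoot (P j)) p (z j)) (G j)
          = ∏ j, (Nat.card (Fin (r j) → Fin (r j) →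
            AdjoinRoot (P j) ⧸ Ideal.span {(p : AdjoinRoot (P j)) ^ (N + 1)}) *
            ckGen (AdjoinRoot (P j)) (G j ⧸ ((p : AdjoinRoot (P j)) •
              (⊤ : Submodule (AdjoinRoot (P j)) (G j)))) (r j)) := by
        rw [Finset.prod_congr rfl (fun j _ => (ck_m2_moment p (N + 1) (r j) (hG j)).symm),
          Finset.prod_univ_sum, Fintype.piFinset_univ]
      rw [h2, Finset.prod_mul_distrib, ← Nat.card_pi]
      ring) G hN'
  have hsplit : Nat.card {z : Ω2 // ∀ j, Nonempty (ckC2 (R := AdjoinRoot (P j)) p (z j)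
      ≃ₗ[AdjoinRoot (P j)] G j)} = ∏ j, Nat.card {z : Fin (r j) → Fin (r j) →
        AdjoinRoot (P j) ⧸ Ideal.span {(p : AdjoinRoot (P j)) ^ (N + 1)} //
        Nonempty (ckC2 (R := AdjoinRoot (P j)) p z ≃ₗ[AdjoinRoot (P j)] G j)} := by
    rw [← Nat.card_pi]
    exact Nat.card_congr (Equiv.subtypePiEquivPi (p := fun j (z : Fin (r j) → Fin (r j) →
        AdjoinRoot (P j) ⧸ Ideal.span {(p : AdjoinRoot (P j)) ^ (N + 1)}) =>
        Nonempty (ckC2 (R := AdjoinRoot (P j)) p z ≃ₗ[AdjoinRoot (P j)] G j)))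
  have hj : ∀ j, (Nat.card {z : Fin (r j) → Fin (r j) →
        AdjoinRoot (P j) ⧸ Ideal.span {(p : AdjoinRoot (P j)) ^ (N + 1)} //
        Nonempty (ckC2 (R := AdjoinRoot (P j)) p z ≃ₗ[AdjoinRoot (P j)] G j)} : ℝ) =
      Nat.card (Fin (r j) → Fin (r j) →
            AdjoinRoot (P j) ⧸ Ideal.span {(p : AdjoinRoot (P j)) ^ (N + 1)}) *
      ((q j : ℝ) ^ (r j ^ 2) * (∏ i ∈ Finset.Icc 1 (r j), (1 - (q j : ℝ)⁻¹ ^ i) ^ 2) /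
          (Nat.card (G j ≃ₗ[AdjoinRoot (P j)] G j) : ℝ)) := by
    intro j
    have h1 := congrArg (Nat.cast : ℕ → ℝ)
      (ck_m2_iso p (q j) (hp0 j) (hmax j) (hcard j) (hqj j) N (r j) (hN j) (hr j))
    rw [Nat.cast_mul, Nat.cast_mul, Nat.cast_mul, Nat.cast_pow _ 2, ck_B _ _ (hqj j)] at h1
    rw [Finset.prod_pow]
    have := ck_finite_hom (R := AdjoinRoot (P j)) (G j) (G j)
    have : Finite (G j ≃ₗ[AdjoinRoot (P j)] G j) :=
      Finite.of_injective (fun e => e.toLinearMap) LinearEquiv.toLinearMap_injective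
    have hA : (Nat.card (G j ≃ₗ[AdjoinRoot (P j)] G j) : ℝ) ≠ 0 :=
      Nat.cast_ne_zero.2 Nat.card_pos.ne'
    have hq0 : (q j : ℝ) ^ (r j ^ 2) ≠ 0 := by
      have := hqj j
      positivity
    push_cast at h1
    rw [← mul_div_assoc, eq_div_iff hA]
    apply mul_right_cancel₀ hq0
    rw [h1]
    ring
  rw [hsplit] at h
  have h' := congrArg (Nat.cast : ℕ → ℝ) h
  rw [Nat.cast_mul, Nat.cast_mul, Nat.cast_prod, Finset.prod_congr rfl (fun j _ => hj j),
    Finset.prod_mul_distrib, ← Nat.cast_prod, ← Nat.card_pi] at h'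
  have hΩ : (Nat.card Ω2 : ℝ) ≠ 0 := Nat.cast_ne_zero.2 Nat.card_pos.ne'
  apply mul_left_cancel₀ hΩ
  rw [h']
  change _ * ((Nat.card Ω2 : ℝ) * _) = _
  ring

end comb


section cok
open Polynomial
variable {p : ℕ} [Fact p.Prime] (Q : ℤ_[p][X]) {n : ℕ}

/-- the submodule defining the truncated cokernel -/
noncomputable abbrev ckL (X : Fin n → Fin n → ℤ_[p]) (c : ℤ_[p]) : Submodule ℤ_[p] (Fin n → ℤ_[p]) :=
  LinearMap.range (Polynomial.aeval (Matrix.of X) Q).mulVecLin ⊔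
    c • (⊤ : Submodule ℤ_[p] (Fin n → ℤ_[p]))

lemma ck_aeval_lin {S : Type*} [CommRing S] (g : S[X]) (X : Matrix (Fin n) (Fin n) S) :
    (Polynomial.aeval X g).mulVecLin = Polynomial.aeval X.mulVecLin g :=
  (Polynomial.aeval_algHom_apply (Matrix.toLinAlgEquiv' (R := S) (n := Fin n)).toAlgHom X g).symm

lemma ck_aeval_mapQ {S V : Type*} [CommRing S] [AddCommGroup V] [Module S V] (K : Submodule S V)
    (T : V →ₗ[S] V) (h : K ≤ K.comap T) (g : S[X]) (v : V) :
    Polynomial.aeval (K.mapQ K T h) g (K.mkQ v) = K.mkQ (Polynomial.aeval T g v) := by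
  induction g using Polynomial.induction_on generalizing v with
  | C a => simp
  | add f g hf hg => simp only [map_add, LinearMap.add_apply, hf, hg]
  | monomial m a ih =>
    rw [pow_succ, ← mul_assoc, map_mul _ (C a * X ^ m), map_mul _ (C a * X ^ m),
      Module.End.mul_apply, Module.End.mul_apply, aeval_X, aeval_X, ← ih]
    rfl

lemma ck_cok_equiv (X0 : Fin n → Fin n → ℤ_[p]) (c : ℤ_[p]) :
    Nonempty (((Fin n → ℤ_[p]) ⧸ ckL Q X0 c) ≃+
      ((Fin n → AdjoinRoot Q) ⧸ ckK (ckA Q X0) (algebraMap ℤ_[p] (AdjoinRoot Q) c))) := by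
  classical
  set T : (Fin n → ℤ_[p]) →ₗ[ℤ_[p]] (Fin n → ℤ_[p]) := (Matrix.of X0).mulVecLin with hT
  set K := ckL Q X0 c with hK
  have hK' : K = LinearMap.range (Polynomial.aeval T Q) ⊔ c • ⊤ := by
    rw [hK, ckL, ck_aeval_lin]
  have hTK : K ≤ K.comap T := by
    conv_lhs => rw [hK']
    rw [hK']
    refine sup_le ?_ ?_
    · rintro _ ⟨v, rfl⟩
      refine Submodule.mem_sup_left ⟨T v, ?_⟩
      have h : aeval T (Q * X) = aeval T (X * Q) := by rw [mul_comm]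
      rw [map_mul, map_mul, aeval_X] at h
      exact congrArg (fun f => f v) h
    · intro v hv
      obtain ⟨w, -, rfl⟩ := (Submodule.mem_smul_pointwise_iff_exists _ _ _).1 hv
      rw [Submodule.mem_comap, map_smul]
      exact Submodule.mem_sup_right (Submodule.smul_mem_pointwise_smul _ _ _ trivial)
  let Tw : Module.End ℤ_[p] ((Fin n → ℤ_[p]) ⧸ K) := K.mapQ K T hTK
  have hQ0 : aeval Tw Q = 0 := by
    refine LinearMap.ext fun w => ?_
    obtain ⟨v, rfl⟩ := K.mkQ_surjective w
    rw [ck_aeval_mapQ, LinearMap.zero_apply, Submodule.mkQ_apply, Submodule.Quotient.mk_eq_zero, hK']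
    exact Submodule.mem_sup_left ⟨v, rfl⟩
  let ρ : AdjoinRoot Q →+* Module.End ℤ_[p] ((Fin n → ℤ_[p]) ⧸ K) :=
    Ideal.Quotient.lift (Ideal.span {Q}) (aeval Tw : ℤ_[p][X] →ₐ[ℤ_[p]] _).toRingHom (by
      intro g hg
      obtain ⟨h, rfl⟩ := Ideal.mem_span_singleton.1 hg
      change aeval Tw (Q * h) = 0
      rw [map_mul, hQ0, zero_mul])
  have hρ : ∀ g, ρ (AdjoinRoot.mk Q g) = aeval Tw g := fun g => rfl
  let : Module (AdjoinRoot Q) ((Fin n → ℤ_[p]) ⧸ K) := Module.compHom _ ρ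
  have hsm : ∀ g w, (AdjoinRoot.mk Q g) • w = aeval Tw g w := fun g w => rfl
  have hsa : ∀ (a : ℤ_[p]) (w : (Fin n → ℤ_[p]) ⧸ K),
      algebraMap ℤ_[p] (AdjoinRoot Q) a • w = a • w := by
    intro a w
    have := hsm (C a) w
    rw [aeval_C] at this
    exact this
  have hsr : ∀ w, AdjoinRoot.root Q • w = Tw w := by
    intro w
    have := hsm X w
    rw [aeval_X] at this
    exact this
  let e : Fin n → (Fin n → ℤ_[p]) ⧸ K := fun i => K.mkQ (Pi.single i 1)
  have hv : ∀ v : Fin n → ℤ_[p], K.mkQ v = ∑ i, v i • e i := by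
    intro v
    simp only [e, ← map_smul, ← map_sum]
    congr 1
    ext k
    simp [Finset.sum_apply, Pi.single_apply]
  let D := (Fin n → AdjoinRoot Q) ⧸ ckK (ckA Q X0) (algebraMap ℤ_[p] (AdjoinRoot Q) c)
  have hker : ∀ v ∈ ckK (ckA Q X0) (algebraMap ℤ_[p] (AdjoinRoot Q) c),
      Fintype.linearCombination (AdjoinRoot Q) e v = 0 := by
    rw [ckK_rel]
    · intro i
      rw [ckA_lin, hsr, sub_eq_zero]
      change _ = K.mkQ (T (Pi.single i 1))
      rw [hv]
      refine Finset.sum_congr rfl fun k _ => ?_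
      rw [hsa]
      congr 1
      simp [T]
    · intro w
      rw [hsa]
      obtain ⟨v, rfl⟩ := K.mkQ_surjective w
      rw [← map_smul, Submodule.mkQ_apply, Submodule.Quotient.mk_eq_zero, hK']
      exact Submodule.mem_sup_right (Submodule.smul_mem_pointwise_smul _ _ _ trivial)
  let β : D →ₗ[AdjoinRoot Q] ((Fin n → ℤ_[p]) ⧸ K) :=
    Submodule.liftQ _ (Fintype.linearCombination (AdjoinRoot Q) e) hker
  -- the map α
  let α0 : (Fin n → ℤ_[p]) →+ D :=
    { toFun := fun v => Submodule.Quotient.mk (fun i => algebraMap ℤ_[p] (AdjoinRoot Q) (v i))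
      map_zero' := by
        simp only [Pi.zero_apply, map_zero]; rfl
      map_add' := by
        intro v w
        simp only [Pi.add_apply, map_add]; rfl }
  have hαs : ∀ (a : ℤ_[p]) v, α0 (a • v) = algebraMap ℤ_[p] (AdjoinRoot Q) a • α0 v := by
    intro a v
    change Submodule.Quotient.mk _ = algebraMap ℤ_[p] (AdjoinRoot Q) a • Submodule.Quotient.mk _
    rw [← Submodule.Quotient.mk_smul]
    congr 1
    ext i
    simp
  have hαT : ∀ v, α0 (T v) = AdjoinRoot.root Q • α0 v := by
    intro v
    rw [← sub_eq_zero]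
    change Submodule.Quotient.mk _ - AdjoinRoot.root Q • Submodule.Quotient.mk _ = _
    rw [← Submodule.Quotient.mk_smul, ← Submodule.Quotient.mk_sub, Submodule.Quotient.mk_eq_zero]
    have : ((fun i => algebraMap ℤ_[p] (AdjoinRoot Q) (T v i)) - AdjoinRoot.root Q •
        fun i => algebraMap ℤ_[p] (AdjoinRoot Q) (v i)) =
        ∑ i, algebraMap ℤ_[p] (AdjoinRoot Q) (v i) • (fun k => ckA Q X0 k i) := by
      ext k
      simp only [Pi.sub_apply, Pi.smul_apply, Finset.sum_apply, ckA, smul_eq_mul, mul_sub,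
        Finset.sum_sub_distrib, mul_ite, mul_zero, Finset.sum_ite_eq, Finset.mem_univ, if_true]
      congr 1
      · simp only [T, Matrix.mulVecLin_apply, Matrix.mulVec, dotProduct, Matrix.of_apply, map_sum,
          map_mul]
        exact Finset.sum_congr rfl fun i _ => mul_comm _ _
      · exact mul_comm _ _
    rw [this]
    exact Submodule.sum_mem _ fun i _ => Submodule.smul_mem _ _
      (Submodule.subset_span (Or.inl ⟨i, rfl⟩))
  have hαg : ∀ g v, α0 (aeval T g v) = AdjoinRoot.mk Q g • α0 v := by
    intro g
    induction g using Polynomial.induction_on with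
    | C a => intro v; simpa using hαs a v
    | add f g hf hg => intro v; simp only [map_add, LinearMap.add_apply, hf, hg, add_smul]
    | monomial m a ih =>
      intro v
      rw [pow_succ, ← mul_assoc, map_mul _ (C a * X ^ m), map_mul _ (C a * X ^ m),
        Module.End.mul_apply, aeval_X, ih, hαT, smul_smul, AdjoinRoot.mk_X]
  have hαK : K.toAddSubgroup ≤ α0.ker := by
    intro v hv
    have hv' : v ∈ K := hv
    rw [hK'] at hv'
    obtain ⟨_, ⟨a, rfl⟩, b, hb, rfl⟩ := Submodule.mem_sup.1 hv'
    obtain ⟨w, -, rfl⟩ := (Submodule.mem_smul_pointwise_iff_exists _ _ _).1 hb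
    rw [AddMonoidHom.mem_ker, map_add, hαg, AdjoinRoot.mk_self, zero_smul, hαs, ckK_smul, add_zero]
  have hαe : ∀ i, α0 (Pi.single i 1) = Submodule.Quotient.mk (Pi.single i 1) := by
    intro i
    change Submodule.Quotient.mk _ = _
    congr 1
    ext k
    by_cases h : k = i
    · subst h; simp
    · simp [h]
  have hαsurj : Function.Surjective α0 := by
    intro d
    obtain ⟨v, rfl⟩ := Submodule.Quotient.mk_surjective _ d
    choose g hg using fun i => AdjoinRoot.mk_surjective (v i)
    refine ⟨∑ i, aeval T (g i) (Pi.single i 1), ?_⟩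
    rw [map_sum]
    have h3 : ∀ i, α0 (aeval T (g i) (Pi.single i 1)) =
        (ckK (ckA Q X0) (algebraMap ℤ_[p] (AdjoinRoot Q) c)).mkQ (v i • Pi.single i 1) := by
      intro i
      rw [hαg, hαe, hg, map_smul]
      rfl
    rw [Finset.sum_congr rfl (fun i _ => h3 i), ← map_sum, Submodule.mkQ_apply]
    congr 1
    ext k
    simp [Finset.sum_apply, Pi.single_apply]
  have hβα : ∀ v, β (α0 v) = K.mkQ v := by
    intro v
    change Fintype.linearCombination (AdjoinRoot Q) e _ = _
    rw [Fintype.linearCombination_apply, hv]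
    exact Finset.sum_congr rfl fun i _ => hsa _ _
  let α : ((Fin n → ℤ_[p]) ⧸ K) →+ D := QuotientAddGroup.lift K.toAddSubgroup α0 hαK
  have hα : ∀ v, α (K.mkQ v) = α0 v := fun v => rfl
  refine ⟨AddEquiv.ofBijective α ⟨?_, ?_⟩⟩
  · intro a b hab
    obtain ⟨a, rfl⟩ := K.mkQ_surjective a
    obtain ⟨b, rfl⟩ := K.mkQ_surjective b
    rw [hα, hα] at hab
    rw [← hβα, ← hβα, hab]
  · intro d
    obtain ⟨v, hv⟩ := hαsurj d
    exact ⟨K.mkQ v, hv⟩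

end cok


section cok2
open Polynomial
variable {p : ℕ} [Fact p.Prime] (Q : ℤ_[p][X]) {n : ℕ}

lemma ck_aeval_map (f : ℤ_[p] →+* ZMod p) (X0 : Matrix (Fin n) (Fin n) ℤ_[p]) :
    (aeval X0 Q).map f = aeval (X0.map f) (Q.map f) := by
  change f.mapMatrix (aeval X0 Q) = aeval (f.mapMatrix X0) (Q.map f)
  rw [aeval_def, aeval_def, hom_eval₂, eval₂_map]
  congr 1
  ext a i j
  simp [Matrix.algebraMap_eq_diagonal, Matrix.diagonal_apply]
  split_ifs <;> simp

lemma ck_toZMod_zero (a : ℤ_[p]) (h : PadicInt.toZMod a = 0) : ∃ b, a = p * b := by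
  rw [← RingHom.mem_ker, PadicInt.ker_toZMod, PadicInt.maximalIdeal_eq_span_p,
      Ideal.mem_span_singleton] at h
  exact h

lemma ck_cok_F (X0 : Fin n → Fin n → ℤ_[p]) :
    Nonempty (((Fin n → ℤ_[p]) ⧸ ckL Q X0 (p : ℤ_[p])) ≃+
      ((Fin n → ZMod p) ⧸ LinearMap.range (aeval ((Matrix.of X0).map (PadicInt.toZMod : ℤ_[p] →+* ZMod p))
        (Q.map (PadicInt.toZMod : ℤ_[p] →+* ZMod p))).mulVecLin)) := by
  set f : ℤ_[p] →+* ZMod p := PadicInt.toZMod with hf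
  rw [← ck_aeval_map]
  set A := aeval (Matrix.of X0) Q with hA
  let π : (Fin n → ℤ_[p]) →+ (Fin n → ZMod p) :=
    { toFun := fun v i => f (v i), map_zero' := by ext; simp, map_add' := by intros; ext; simp }
  have hπ : Function.Surjective π := by
    intro w
    choose v hv using fun i => ZMod.ringHom_surjective f (w i)
    exact ⟨v, funext hv⟩
  have hπA : ∀ v, π (A.mulVecLin v) = (A.map f).mulVecLin (π v) := by
    intro v
    ext i
    simp only [Matrix.mulVecLin_apply]
    exact RingHom.map_mulVec f A v i
  let S := LinearMap.range (A.map f).mulVecLin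
  let ψ : (Fin n → ℤ_[p]) →+ ((Fin n → ZMod p) ⧸ S) := S.mkQ.toAddMonoidHom.comp π
  have hψ : Function.Surjective ψ := S.mkQ_surjective.comp hπ
  have hker : ψ.ker = (ckL Q X0 (p : ℤ_[p])).toAddSubgroup := by
    ext v
    rw [AddMonoidHom.mem_ker]
    change S.mkQ (π v) = 0 ↔ v ∈ ckL Q X0 (p : ℤ_[p])
    rw [Submodule.mkQ_apply, Submodule.Quotient.mk_eq_zero]
    constructor
    · rintro ⟨w, hw⟩
      obtain ⟨w, rfl⟩ := hπ w
      rw [← hπA] at hw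
      have h0 : ∀ i, f ((v - A.mulVecLin w) i) = 0 := by
        intro i
        have := congrFun hw i
        change f _ = f _ at this
        rw [Pi.sub_apply, map_sub, this, sub_self]
      choose b hb using fun i => ck_toZMod_zero _ (h0 i)
      refine Submodule.mem_sup.2 ⟨A.mulVecLin w, ⟨w, rfl⟩, (p : ℤ_[p]) • b,
        Submodule.smul_mem_pointwise_smul _ _ _ trivial, ?_⟩
      have : (p : ℤ_[p]) • b = v - A.mulVecLin w := by
        ext1 i; rw [hb]; rfl
      rw [this]; abel
    · intro h
      obtain ⟨_, ⟨w, rfl⟩, b, hb, rfl⟩ := Submodule.mem_sup.1 h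
      obtain ⟨b, -, rfl⟩ := (Submodule.mem_smul_pointwise_iff_exists _ _ _).1 hb
      refine ⟨π w, ?_⟩
      rw [map_add, ← hπA]
      have : π ((p : ℤ_[p]) • b) = 0 := by
        ext i
        change f ((p : ℤ_[p]) * b i) = 0
        rw [map_mul, map_natCast, CharP.cast_eq_zero, zero_mul]
      rw [this, add_zero]
  exact ⟨(QuotientAddGroup.quotientAddEquivOfEq hker.symm).trans
    (QuotientAddGroup.quotientKerEquivOfSurjective ψ hψ)⟩

lemma ck_D1_equiv (X0 : Fin n → Fin n → ℤ_[p]) :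
    Nonempty (((Fin n → AdjoinRoot Q) ⧸ ckK (ckA Q X0) (p : AdjoinRoot Q)) ≃+
      ((Fin n → ZMod p) ⧸ LinearMap.range (aeval ((Matrix.of X0).map (PadicInt.toZMod : ℤ_[p] →+* ZMod p))
        (Q.map (PadicInt.toZMod : ℤ_[p] →+* ZMod p))).mulVecLin)) := by
  obtain ⟨e⟩ := ck_cok_equiv Q X0 (p : ℤ_[p])
  obtain ⟨e'⟩ := ck_cok_F Q X0
  rw [map_natCast] at e
  exact ⟨e.symm.trans e'⟩

section withG
variable {q : ℕ} {G : Type} [AddCommGroup G] [Module (AdjoinRoot Q) G] [Finite G] {r : ℕ}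

lemma ck_q_gt (hm : Q.Monic) (hirr : Irreducible (Q.map (PadicInt.toZMod : ℤ_[p] →+* ZMod p)))
    (hq : q = p ^ Q.natDegree) : 1 < q := by
  rw [hq]
  apply Nat.one_lt_pow
  · have := hirr.natDegree_pos
    rw [hm.natDegree_map] at this
    omega
  · exact (Fact.out : p.Prime).one_lt

lemma ck_condF (hm : Q.Monic) (hirr : Irreducible (Q.map (PadicInt.toZMod : ℤ_[p] →+* ZMod p)))
    (hq : q = p ^ Q.natDegree) 
    (hr : Nat.card (G ⧸ ((p : AdjoinRoot Q) • (⊤ : Submodule (AdjoinRoot Q) G))) = q ^ r)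
    (X0 : Fin n → Fin n → ℤ_[p]) :
    Nonempty (((Fin n → ZMod p) ⧸ LinearMap.range
      (aeval ((Matrix.of X0).map (PadicInt.toZMod : ℤ_[p] →+* ZMod p))
        (Q.map (PadicInt.toZMod : ℤ_[p] →+* ZMod p))).mulVecLin) ≃+
        (G ⧸ ((p : AdjoinRoot Q) • (⊤ : Submodule (AdjoinRoot Q) G)))) ↔
      Nat.card ((Fin n → AdjoinRoot Q) ⧸ ckK (ckA Q X0) (p : AdjoinRoot Q)) = q ^ r := by
  have hq1 := ck_q_gt Q hm hirr hq
  obtain ⟨e⟩ := ck_D1_equiv Q X0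
  constructor
  · rintro ⟨e'⟩
    rw [← hr]
    exact Nat.card_congr (e.trans e').toEquiv
  · intro h
    have hfin : Finite ((Fin n → AdjoinRoot Q) ⧸ ckK (ckA Q X0) (p : AdjoinRoot Q)) := by
      apply Nat.finite_of_card_ne_zero
      rw [h]; positivity
    have : Finite (G ⧸ ((p : AdjoinRoot Q) • (⊤ : Submodule (AdjoinRoot Q) G))) :=
      Finite.of_surjective _ (Submodule.mkQ_surjective _)
    obtain ⟨e1⟩ := (ck_field_stuff p q (ck_R_max Q hirr)
      ((ck_R_card Q hm).trans hq.symm) hq1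
      (H := (Fin n → AdjoinRoot Q) ⧸ ckK (ckA Q X0) (p : AdjoinRoot Q))
      (fun x => by rw [← Nat.cast_smul_eq_nsmul (AdjoinRoot Q), ckK_smul]) h).1
    obtain ⟨e2⟩ := (ck_field_stuff p q (ck_R_max Q hirr)
      ((ck_R_card Q hm).trans hq.symm) hq1 (ck_quot_killed p G) hr).1
    exact ⟨e.symm.trans (e1.trans e2.symm).toAddEquiv⟩

lemma ck_L_eq (X0 : Fin n → Fin n → ℤ_[p]) (N : ℕ) :
    (((p : ℤ_[p]) ^ N • (⊤ : Submodule ℤ_[p] (Fin n → ℤ_[p]))) ≤ ckL Q X0 ((p : ℤ_[p]) ^ (N + 1))) →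
    ((p : ℤ_[p]) ^ N • (⊤ : Submodule ℤ_[p] (Fin n → ℤ_[p]))) ≤
      LinearMap.range (Polynomial.aeval (Matrix.of X0) Q).mulVecLin := by
  intro h
  refine Submodule.le_of_le_smul_of_le_jacobson_bot (I := IsLocalRing.maximalIdeal ℤ_[p])
    (IsNoetherian.noetherian _) (IsLocalRing.maximalIdeal_le_jacobson _) ?_
  refine h.trans (sup_le_sup_left ?_ _)
  intro v hv
  obtain ⟨w, -, rfl⟩ := (Submodule.mem_smul_pointwise_iff_exists _ _ _).1 hv
  rw [pow_succ, mul_comm, mul_smul]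
  refine Submodule.smul_mem_smul ?_ (Submodule.smul_mem_pointwise_smul _ _ _ trivial)
  rw [PadicInt.maximalIdeal_eq_span_p]
  exact Ideal.mem_span_singleton_self _

lemma ck_killed_le {V : Type*} [AddCommGroup V] [Module ℤ_[p] V] (K : Submodule ℤ_[p] V)
    {H : Type*} [AddCommGroup H] (e : (V ⧸ K) ≃+ H) (N : ℕ) (hN : ∀ x : H, p ^ N • x = 0) :
    (p : ℤ_[p]) ^ N • (⊤ : Submodule ℤ_[p] V) ≤ K := by
  intro v hv
  obtain ⟨w, -, rfl⟩ := (Submodule.mem_smul_pointwise_iff_exists _ _ _).1 hv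
  rw [← Submodule.Quotient.mk_eq_zero, ← Nat.cast_pow, Nat.cast_smul_eq_nsmul,
    Submodule.Quotient.mk_smul]
  apply e.injective
  rw [map_nsmul, hN, map_zero]

lemma ck_condT (hm : Q.Monic) (hirr : Irreducible (Q.map (PadicInt.toZMod : ℤ_[p] →+* ZMod p)))
    (hq : q = p ^ Q.natDegree) (N : ℕ) (hN : ∀ x : G, p ^ N • x = 0) (X0 : Fin n → Fin n → ℤ_[p]) :
    Nonempty (((Fin n → ℤ_[p]) ⧸
        LinearMap.range (Polynomial.aeval (Matrix.of X0) Q).mulVecLin) ≃+ G) ↔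
    Nonempty (((Fin n → AdjoinRoot Q) ⧸ ckK (ckA Q X0) ((p : AdjoinRoot Q) ^ (N + 1)))
      ≃ₗ[AdjoinRoot Q] G) := by
  have hq1 := ck_q_gt Q hm hirr hq
  have := ck_R_dom Q hm hirr
  have := ck_R_pid Q hm hirr
  obtain ⟨e⟩ := ck_cok_equiv Q X0 ((p : ℤ_[p]) ^ (N + 1))
  rw [map_pow, map_natCast] at e
  have hle : ((p : ℤ_[p]) ^ N • (⊤ : Submodule ℤ_[p] (Fin n → ℤ_[p]))) ≤
      LinearMap.range (Polynomial.aeval (Matrix.of X0) Q).mulVecLin →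
      ckL Q X0 ((p : ℤ_[p]) ^ (N + 1)) =
        LinearMap.range (Polynomial.aeval (Matrix.of X0) Q).mulVecLin := by
    intro h
    refine sup_eq_left.2 (le_trans ?_ h)
    intro v hv
    obtain ⟨w, -, rfl⟩ := (Submodule.mem_smul_pointwise_iff_exists _ _ _).1 hv
    rw [pow_succ, mul_smul]
    exact Submodule.smul_mem_pointwise_smul _ _ _ trivial
  constructor
  · rintro ⟨e'⟩
    have h1 := hle (ck_killed_le _ e' N hN)
    rw [h1] at e
    obtain ⟨e2⟩ := ck_classify p q (ck_R_p0 Q hm hirr) (ck_R_max Q hirr)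
      ((ck_R_card Q hm).trans hq.symm) hq1 N hN (e'.symm.trans e)
    exact ⟨e2.symm⟩
  · rintro ⟨e'⟩
    have e2 := e.trans e'.toAddEquiv
    rw [hle (ck_L_eq Q X0 N (ck_killed_le _ e2 N hN))] at e2
    exact ⟨e2⟩

lemma ck_T_imp 
    (hr : Nat.card (G ⧸ ((p : AdjoinRoot Q) • (⊤ : Submodule (AdjoinRoot Q) G))) = q ^ r)
    (X0 : Fin n → Fin n → ℤ_[p])
    (h : Nonempty (((Fin n → ℤ_[p]) ⧸
        LinearMap.range (Polynomial.aeval (Matrix.of X0) Q).mulVecLin) ≃+ G)) :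
    Nat.card ((Fin n → AdjoinRoot Q) ⧸ ckK (ckA Q X0) (p : AdjoinRoot Q)) = q ^ r := by
  obtain ⟨e'⟩ := h
  obtain ⟨e⟩ := ck_cok_equiv Q X0 (p : ℤ_[p])
  rw [map_natCast] at e
  rw [← Nat.card_congr e.toEquiv, ← hr]
  set S := LinearMap.range (Polynomial.aeval (Matrix.of X0) Q).mulVecLin with hS
  have e3 := Submodule.quotientQuotientEquivQuotientSup S
    ((p : ℤ_[p]) • (⊤ : Submodule ℤ_[p] (Fin n → ℤ_[p])))
  rw [Submodule.map_pointwise_smul, Submodule.map_top, Submodule.range_mkQ] at e3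
  rw [← Nat.card_congr e3.toEquiv]
  have : Finite ((Fin n → ℤ_[p]) ⧸ S) := Finite.of_equiv _ e'.symm.toEquiv
  have h1 := ck_quot_mul (R := ℤ_[p]) p ((Fin n → ℤ_[p]) ⧸ S)
  have h2 := ck_quot_mul (R := AdjoinRoot Q) p G
  have h3 : Nat.card (ckP p ((Fin n → ℤ_[p]) ⧸ S)) = Nat.card (ckP p G) := by
    refine Nat.card_congr (Equiv.subtypeEquiv e'.toEquiv fun x => ?_)
    constructor
    · rintro ⟨y, rfl⟩
      exact ⟨e' y, (map_nsmul e' p y).symm⟩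
    · rintro ⟨y, hy⟩
      refine ⟨e'.symm y, e'.injective ?_⟩
      change e' (p • e'.symm y) = e' x
      rw [map_nsmul, e'.apply_symm_apply]
      exact hy
  rw [Nat.card_congr e'.toEquiv, h2, h3] at h1
  exact (Nat.eq_of_mul_eq_mul_left Nat.card_pos h1).symm

end withG

lemma ck_K_congr (X0 X1 : Fin n → Fin n → ℤ_[p]) (c : ℤ_[p]) (h : ∀ k i, c ∣ X1 k i - X0 k i) :
    ckK (ckA Q X0) (algebraMap ℤ_[p] (AdjoinRoot Q) c) =
      ckK (ckA Q X1) (algebraMap ℤ_[p] (AdjoinRoot Q) c) := by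
  have key : ∀ X0 X1 : Fin n → Fin n → ℤ_[p], (∀ k i, c ∣ X1 k i - X0 k i) →
    ckK (ckA Q X0) (algebraMap ℤ_[p] (AdjoinRoot Q) c) ≤
      ckK (ckA Q X1) (algebraMap ℤ_[p] (AdjoinRoot Q) c) := by
    intro X0 X1 h
    choose b hb using h
    rw [ckK, Submodule.span_le]
    rintro _ (⟨i, rfl⟩ | ⟨i, rfl⟩)
    · have h1 : (fun k => ckA Q X0 k i) = (fun k => ckA Q X1 k i) -
          algebraMap ℤ_[p] (AdjoinRoot Q) c • fun k => algebraMap ℤ_[p] (AdjoinRoot Q) (b k i) := by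
        ext k
        have : X0 k i = X1 k i - c * b k i := by rw [← hb]; ring
        simp only [Pi.sub_apply, Pi.smul_apply, ckA, this, map_sub, map_mul, smul_eq_mul]
        ring
      change (fun k => ckA Q X0 k i) ∈ _
      rw [h1]
      refine Submodule.sub_mem _ (Submodule.subset_span (Or.inl ⟨i, rfl⟩)) ?_
      rw [← Submodule.Quotient.mk_eq_zero, Submodule.Quotient.mk_smul, ckK_smul]
    · exact Submodule.subset_span (Or.inr ⟨i, rfl⟩)
  exact le_antisymm (key _ _ h) (key _ _ fun k i => by rw [← neg_sub]; exact (h k i).neg_right)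

end cok2


section meas
variable {p : ℕ} [Fact p.Prime] {n : ℕ}

lemma ck_borel : BorelSpace ℤ_[p] := ⟨rfl⟩

lemma ck_measure {K : Type} [CommRing K] [Finite K] (f : ℤ_[p] →+* K) (hf : Function.Surjective f)
    (m : ℕ) (hker : ∀ x, (p : ℤ_[p]) ^ m ∣ x → f x = 0)
    (μ : Measure (Fin n → Fin n → ℤ_[p])) [IsProbabilityMeasure μ] [μ.IsAddHaarMeasure]
    (S : (Fin n → Fin n → K) → Prop) :
    (μ {X | S (fun i j => f (X i j))}).toReal =
      (Nat.card {w // S w} : ℝ) / Nat.card (Fin n → Fin n → K) := by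
  classical
  have := ck_borel (p := p)
  have : Fintype K := Fintype.ofFinite K
  let ρ : (Fin n → Fin n → ℤ_[p]) → (Fin n → Fin n → K) := fun X i j => f (X i j)
  have hadd : ∀ X Y, ρ (X + Y) = ρ X + ρ Y := by
    intro X Y; ext i j; exact map_add f _ _
  have hsurj : Function.Surjective ρ := by
    intro w
    choose v hv using fun i j => hf (w i j)
    exact ⟨v, by ext i j; exact hv i j⟩
  have hopen : ∀ a : K, IsOpen (f ⁻¹' {a}) := by
    intro a
    rw [Metric.isOpen_iff]
    intro x hx
    refine ⟨(p : ℝ) ^ (-m : ℤ), zpow_pos (by exact_mod_cast (Fact.out : p.Prime).pos) _, ?_⟩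
    intro y hy
    have h1 : ‖y - x‖ ≤ (p : ℝ) ^ (-m : ℤ) := by
      rw [← dist_eq_norm]; exact (Metric.mem_ball.1 hy).le
    rw [PadicInt.norm_le_pow_iff_mem_span_pow, Ideal.mem_span_singleton] at h1
    have := hker _ h1
    rw [map_sub, sub_eq_zero] at this
    change f y = a
    rw [this]; exact hx
  have hmeas : ∀ w, MeasurableSet (ρ ⁻¹' {w}) := by
    intro w
    have : ρ ⁻¹' {w} = ⋂ i, ⋂ j, (fun X : Fin n → Fin n → ℤ_[p] => X i j) ⁻¹' (f ⁻¹' {w i j}) := by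
      ext X
      simp only [Set.mem_preimage, Set.mem_singleton_iff, Set.mem_iInter, ρ, funext_iff]
    rw [this]
    refine MeasurableSet.iInter fun i => MeasurableSet.iInter fun j => ?_
    exact ((measurable_pi_apply j).comp (measurable_pi_apply i)) (hopen _).measurableSet
  have hconst : ∀ w, μ (ρ ⁻¹' {w}) = μ (ρ ⁻¹' {0}) := by
    intro w
    obtain ⟨x, rfl⟩ := hsurj w
    rw [← measure_preimage_add μ x (ρ ⁻¹' {ρ x})]
    congr 1
    ext y
    simp [hadd]
  have hS : ∀ S : (Fin n → Fin n → K) → Prop, (μ {X | S (ρ X)}).toReal =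
      Nat.card {w // S w} * (μ (ρ ⁻¹' {0})).toReal := by
    intro S
    have h1 : {X | S (ρ X)} = ⋃ w ∈ Finset.univ.filter S, ρ ⁻¹' {w} := by
      ext X; simp
    rw [h1, measure_biUnion_finset, Finset.sum_congr rfl fun w _ => hconst w, Finset.sum_const,
      nsmul_eq_mul, ENNReal.toReal_mul, ENNReal.toReal_natCast, Nat.card_eq_fintype_card,
      Fintype.card_subtype]
    · intro a _ b _ hab
      refine Set.disjoint_left.2 fun x hx hx' => hab ?_
      exact (Set.mem_singleton_iff.1 hx).symm.trans (Set.mem_singleton_iff.1 hx')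
    · intro w _; exact hmeas w
  have h1 := hS fun _ => True
  simp only [Set.ofPred_true, measure_univ, ENNReal.toReal_one] at h1
  have h2 : Nat.card {w : Fin n → Fin n → K // True} = Nat.card (Fin n → Fin n → K) :=
    Nat.card_congr (Equiv.subtypeUnivEquiv fun _ => trivial)
  rw [h2] at h1
  have h3 : (Nat.card (Fin n → Fin n → K) : ℝ) ≠ 0 := by
    intro h; rw [h, zero_mul] at h1; exact one_ne_zero h1
  change (μ {X | S (ρ X)}).toReal = _
  rw [hS S, eq_div_iff h3, mul_assoc, mul_comm (ENNReal.toReal _), ← h1, mul_one]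

lemma ck_toZMod_p (x : ℤ_[p]) (h : (p : ℤ_[p]) ^ 1 ∣ x) : PadicInt.toZMod x = 0 := by
  obtain ⟨b, rfl⟩ := h
  simp

lemma ck_toZModPow_p (m : ℕ) (x : ℤ_[p]) : PadicInt.toZModPow m x = 0 ↔ (p : ℤ_[p]) ^ m ∣ x := by
  rw [← RingHom.mem_ker, PadicInt.ker_toZModPow, Ideal.mem_span_singleton]

lemma ck_count (M : ℕ) (hM : 1 ≤ M)
    (μ : Measure (Fin n → Fin n → ℤ_[p])) [IsProbabilityMeasure μ] [μ.IsAddHaarMeasure]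
    (T : (Fin n → Fin n → ℤ_[p]) → Prop) (S : (Fin n → Fin n → ZMod p) → Prop)
    (hT : ∀ X X', (∀ i j, (p : ℤ_[p]) ^ M ∣ X' i j - X i j) → (T X ↔ T X'))
    (hTS : ∀ X, T X → S (fun i j => PadicInt.toZMod (X i j))) (c : ℝ)
    (hc : ∀ X0, S (fun i j => PadicInt.toZMod (X0 i j)) →
      (Nat.card {Y : Fin n → Fin n → ZMod (p ^ M) // T (ckLift X0 Y)} : ℝ) =
        Nat.card (Fin n → Fin n → ZMod (p ^ M)) * c) :
    (μ {X | T X}).toReal =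
      c * ((Nat.card {w // S w} : ℝ) / Nat.card (Fin n → Fin n → ZMod p)) := by
  classical
  have hpM : NeZero (p ^ M) := ⟨pow_ne_zero _ (Fact.out : p.Prime).ne_zero⟩
  let g : ℤ_[p] →+* ZMod (p ^ M) := PadicInt.toZModPow M
  let Z := Fin n → Fin n → ZMod (p ^ M)
  let lift : Z → (Fin n → Fin n → ℤ_[p]) := fun w i j => ((w i j).val : ℤ_[p])
  have hgl : ∀ w : Z, (fun i j => g (lift w i j)) = w := by
    intro w; ext i j; simp [lift]
  have hTg : ∀ X X' : Fin n → Fin n → ℤ_[p], (∀ i j, g (X i j) = g (X' i j)) → (T X ↔ T X') := by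
    intro X X' h
    apply hT
    intro i j
    rw [← ck_toZModPow_p, map_sub, sub_eq_zero]
    exact (h i j).symm
  have hSg : ∀ X X' : Fin n → Fin n → ℤ_[p], (∀ i j, (p : ℤ_[p]) ∣ X i j - X' i j) →
      (S (fun i j => PadicInt.toZMod (X i j)) ↔ S (fun i j => PadicInt.toZMod (X' i j))) := by
    intro X X' h
    have : (fun i j => PadicInt.toZMod (X i j)) = (fun i j => PadicInt.toZMod (X' i j)) := by
      ext i j
      rw [← sub_eq_zero, ← map_sub]
      exact ck_toZMod_p _ (by rw [pow_one]; exact h i j)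
    rw [this]
  have hTl : ∀ X, T X ↔ T (lift fun i j => g (X i j)) := by
    intro X
    apply hTg
    intro i j
    exact (congrFun (congrFun (hgl fun i j => g (X i j)) i) j).symm
  have hSl : ∀ X : Fin n → Fin n → ℤ_[p], S (fun i j => PadicInt.toZMod (X i j)) ↔
      S (fun i j => PadicInt.toZMod (lift (fun i j => g (X i j)) i j)) := by
    intro X
    apply hSg
    intro i j
    refine (dvd_pow_self _ (by omega)).trans ((ck_toZModPow_p M _).1 ?_)
    rw [map_sub, sub_eq_zero]
    exact (congrFun (congrFun (hgl fun i j => g (X i j)) i) j).symm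
  have hsurjg : Function.Surjective g := ZMod.ringHom_surjective g
  have hkg : ∀ x, (p : ℤ_[p]) ^ M ∣ x → g x = 0 := fun x h => (ck_toZModPow_p M x).2 h
  have e1 := ck_measure g hsurjg M hkg μ (fun w => T (lift w))
  have e2 := ck_measure g hsurjg M hkg μ (fun w => S (fun i j => PadicInt.toZMod (lift w i j)))
  have e3 := ck_measure (PadicInt.toZMod : ℤ_[p] →+* ZMod p) (ZMod.ringHom_surjective _) 1
    ck_toZMod_p μ S
  simp only [← hTl] at e1
  simp only [← hSl] at e2
  rw [e3] at e2
  rw [e2, e1]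
  -- double count
  have hZ : (Nat.card Z : ℝ) ≠ 0 := by
    exact_mod_cast Nat.card_pos.ne'
  have d1 : (Nat.card {x : Z × Z // T (ckLift (lift x.1) x.2)} : ℝ) =
      Nat.card {w : Z // S (fun i j => PadicInt.toZMod (lift w i j))} * (Nat.card Z * c) := by
    rw [Nat.card_congr (Equiv.subtypeProdEquivSigmaSubtype
      (fun (a : Z) (b : Z) => T (ckLift (lift a) b))), Nat.card_sigma, Nat.cast_sum]
    have : ∀ w : Z, (Nat.card {Y : Z // T (ckLift (lift w) Y)} : ℝ) =
        if S (fun i j => PadicInt.toZMod (lift w i j)) then Nat.card Z * c else 0 := by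
      intro w
      split_ifs with h
      · exact hc _ h
      · have : IsEmpty {Y : Z // T (ckLift (lift w) Y)} := by
          refine ⟨fun Y => h ?_⟩
          refine (hSg _ _ fun i j => ?_).1 (hTS _ Y.2)
          simp [ckLift]
        simp
    rw [Finset.sum_congr rfl fun w _ => this w, ← Finset.sum_filter, Finset.sum_const,
      nsmul_eq_mul, Nat.card_eq_fintype_card (α := {w : Z // S _}), Fintype.card_subtype]
  have d2 : Nat.card {x : Z × Z // T (ckLift (lift x.1) x.2)} =
      Nat.card Z * Nat.card {w : Z // T (lift w)} := by
    rw [mul_comm, ← Nat.card_prod]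
    let e : Z × Z ≃ Z × Z :=
      { toFun := fun x => (fun i j => x.1 i j + p * x.2 i j, x.2)
        invFun := fun x => (fun i j => x.1 i j - p * x.2 i j, x.2)
        left_inv := by intro x; ext <;> simp
        right_inv := by intro x; ext <;> simp }
    refine (Nat.card_congr (Equiv.subtypeEquiv e (q := fun x => T (lift x.1)) fun x => ?_)).trans
      (Nat.card_congr ?_)
    · apply hTg
      intro i j
      rw [congrFun (congrFun (hgl (e x).1) i) j]
      simp only [ckLift, map_add, map_mul, map_natCast, lift, e, ZMod.natCast_val, ZMod.cast_id]
      simp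
    · exact
        { toFun := fun x => (⟨x.1.1, x.2⟩, x.1.2)
          invFun := fun x => ⟨(x.1.1, x.2), x.1.2⟩
          left_inv := fun x => rfl
          right_inv := fun x => rfl }
  rw [d2, Nat.cast_mul] at d1
  have d3 : (Nat.card {w : Z // T (lift w)} : ℝ) =
    Nat.card {w : Z // S (fun i j => PadicInt.toZMod (lift w i j))} * c := by
    apply mul_left_cancel₀ hZ
    rw [d1]; ring
  change (Nat.card {w : Z // T (lift w)} : ℝ) / _ = _
  rw [d3]
  ring

lemma ck_exists_N (Q : Polynomial ℤ_[p]) (G : Type) [AddCommGroup G] [Module (AdjoinRoot Q) G]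
    [Finite G] : ∃ N : ℕ, ∀ x : G, p ^ N • x = 0 := by
  obtain ⟨N, m, hm, he⟩ := Nat.exists_eq_pow_mul_and_not_dvd (n := Nat.card G) Nat.card_pos.ne' p
    (Fact.out : p.Prime).ne_one
  refine ⟨N, fun x => ?_⟩
  have hu : IsUnit ((m : ℕ) : ℤ_[p]) := by
    rw [PadicInt.isUnit_iff, PadicInt.norm_natCast_eq_one_iff]
    exact ((Fact.out : p.Prime).coprime_iff_not_dvd).2 hm
  have hu' : IsUnit ((m : ℕ) : AdjoinRoot Q) := by
    have := hu.map (algebraMap ℤ_[p] (AdjoinRoot Q))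
    rwa [map_natCast] at this
  have h0 : m • (p ^ N • x) = 0 := by
    rw [← mul_smul, mul_comm, ← he]
    exact card_nsmul_eq_zero'
  rw [← Nat.cast_smul_eq_nsmul (AdjoinRoot Q)] at h0
  exact (hu'.smul_eq_zero).1 h0

end meas


/-- Theorem 1.2: for every `n`, the Haar probability that `cok(P_j(X)) ≃ G_j`
for all `j` equals `∏_j q_j^{r_j²} ∏_{i=1}^{r_j}(1-q_j^{-i})² / |Aut(G_j)|` times
the probability that a uniformly random `X̄ ∈ Mat_n(𝔽_p)` satisfies
`cok(P_j(X̄)) ≃ G_j/pG_j` for all `j`.  (Per the paper's remark, finite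
`ℤ_p[t]/(P_j)`-modules are isomorphic iff they are isomorphic as abelian groups,
so the cokernel conditions are stated via `≃+`.) -/
theorem stmt_12 (p : ℕ) [Fact p.Prime] (l : ℕ) (hl : 1 ≤ l)
    (P : Fin l → Polynomial ℤ_[p]) (hmonic : ∀ j, (P j).Monic)
    (hdeg : ∀ j, (P j).natDegree ≤ 2)
    (hirr : ∀ j, Irreducible ((P j).map (PadicInt.toZMod : ℤ_[p] →+* ZMod p)))
    (hdist : ∀ j k, j ≠ k →
      (P j).map (PadicInt.toZMod : ℤ_[p] →+* ZMod p) ≠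
      (P k).map (PadicInt.toZMod : ℤ_[p] →+* ZMod p))
    (q : Fin l → ℕ) (hq : ∀ j, q j = p ^ (P j).natDegree)
    (G : Fin l → Type) [∀ j, AddCommGroup (G j)]
    [∀ j, Module (AdjoinRoot (P j)) (G j)] [∀ j, Finite (G j)]
    (r : Fin l → ℕ)
    (hr : ∀ j, Nat.card ((G j) ⧸ ((p : AdjoinRoot (P j)) •
        (⊤ : Submodule (AdjoinRoot (P j)) (G j)))) = q j ^ r j)
    (n : ℕ) (hn : 1 ≤ n)
    (μ : Measure (Fin n → Fin n → ℤ_[p])) [IsProbabilityMeasure μ]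
    [μ.IsAddHaarMeasure] :
    (μ {X | ∀ j, Nonempty (((Fin n → ℤ_[p]) ⧸
        LinearMap.range (Polynomial.aeval (Matrix.of X) (P j)).mulVecLin) ≃+ G j)}).toReal =
      (∏ j, (q j : ℝ) ^ (r j ^ 2) *
          (∏ i ∈ Finset.Icc 1 (r j), (1 - (q j : ℝ)⁻¹ ^ i) ^ 2) /
          (Nat.card (G j ≃ₗ[AdjoinRoot (P j)] G j) : ℝ)) *
      ((Nat.card {Xb : Matrix (Fin n) (Fin n) (ZMod p) //
          ∀ j, Nonempty (((Fin n → ZMod p) ⧸ LinearMap.range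
            (Polynomial.aeval Xb
              ((P j).map (PadicInt.toZMod : ℤ_[p] →+* ZMod p))).mulVecLin) ≃+
            ((G j) ⧸ ((p : AdjoinRoot (P j)) •
              (⊤ : Submodule (AdjoinRoot (P j)) (G j)))))} : ℝ) /
        (Nat.card (Matrix (Fin n) (Fin n) (ZMod p)) : ℝ)) := by
  choose N0 hN0 using fun j => ck_exists_N (P j) (G j)
  let N := Finset.univ.sup N0
  have hN : ∀ j (x : G j), p ^ N • x = 0 := by
    intro j x
    obtain ⟨d, hd⟩ := Nat.exists_eq_add_of_le (Finset.le_sup (f := N0) (Finset.mem_univ j))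
    change N = _ at hd
    rw [hd, add_comm, pow_add, mul_smul, hN0, smul_zero]
  have hcT := fun j (X : Fin n → Fin n → ℤ_[p]) =>
    ck_condT (P j) (hmonic j) (hirr j) (hq j) N (hN j) X
  have hcF := fun j (X : Fin n → Fin n → ℤ_[p]) =>
    ck_condF (P j) (hmonic j) (hirr j) (hq j) (hr j) X
  refine ck_count (N + 1) (by omega) μ
    (fun X => ∀ j, Nonempty (((Fin n → ℤ_[p]) ⧸
        LinearMap.range (Polynomial.aeval (Matrix.of X) (P j)).mulVecLin) ≃+ G j))
    (fun Xb : Matrix (Fin n) (Fin n) (ZMod p) => ∀ j, Nonempty (((Fin n → ZMod p) ⧸ LinearMap.range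
            (Polynomial.aeval Xb
              ((P j).map (PadicInt.toZMod : ℤ_[p] →+* ZMod p))).mulVecLin) ≃+
            ((G j) ⧸ ((p : AdjoinRoot (P j)) •
              (⊤ : Submodule (AdjoinRoot (P j)) (G j)))))) ?_ ?_ _ ?_
  · intro X X' h
    refine forall_congr' fun j => ?_
    rw [hcT, hcT]
    have := ck_K_congr (P j) X X' _ h
    rw [map_pow, map_natCast] at this
    rw [this]
  · intro X h j
    exact (hcF j X).2 (ck_T_imp (P j) (hr j) X (h j))
  · intro X0 h
    simp only [hcT]
    exact ck_combine P hmonic hirr hdist G q r hq hr N hN X0 (fun j => (hcF j X0).1 (h j))
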